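/- Blow-up of a fixed point: let f: M → M be an expansive homeomorphism of a compact metric space with the specification property, p a fixed point of f, and B a closed ball around p. Let h: M → M be a continuous map with h(B) = {p} and such that h restricted to M∖B is a bijection onto M∖{p}. Let g_B: B → B be a homeomorphism with h_top(g_B, B) = 0, and suppose that the map g: M → M defined by g(x) = g_B(x) for x ∈ B and g(x) = h⁻¹(f(h(x))) for x ∉ B is a homeomorphism. Then g has a unique measure of maximal entropy. -/

import Mathlib

open MeasureTheory Filter Topology Set
open scoped ENNReal NNReal

namespace Samva

variable {X : Type*}

/-- The `n`-th iterate (`n : ℤ`) of a homeomorphism. -/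
noncomputable def zIter [TopologicalSpace X] (f : X ≃ₜ X) : ℤ → X → X
  | Int.ofNat n => (f : X → X)^[n]
  | Int.negSucc n => (f.symm : X → X)^[n + 1]

/-- `f` is expansive with expansivity constant `α`. -/
def IsExpansiveWith [PseudoMetricSpace X] (f : X ≃ₜ X) (α : ℝ) : Prop :=
  0 < α ∧ ∀ x y : X, (∀ n : ℤ, dist (zIter f n x) (zIter f n y) ≤ α) → x = y

/-- `f` is expansive. -/
def IsExpansive [PseudoMetricSpace X] (f : X ≃ₜ X) : Prop :=
  ∃ α : ℝ, IsExpansiveWith f α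

/-- The (periodic) specification property. -/
def HasSpecification [PseudoMetricSpace X] (f : X ≃ₜ X) : Prop :=
  ∀ ε : ℝ, 0 < ε → ∃ M : ℕ, ∀ (k : ℕ) (x : Fin (k + 1) → X) (a b : Fin (k + 1) → ℤ),
    (∀ i, a i ≤ b i) →
    (∀ i : Fin k, (M : ℤ) ≤ a i.succ - b i.castSucc) →
    ∀ p : ℤ, (M : ℤ) + b (Fin.last k) - a 0 ≤ p →
      ∃ z : X, zIter f p z = z ∧
        ∀ i, ∀ j : ℤ, a i ≤ j → j ≤ b i → dist (zIter f j z) (zIter f j (x i)) ≤ ε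

/-- The set of `n`-periodic points. -/
def perSet (f : X → X) (n : ℕ) : Set X := {x | f^[n] x = x}

/-- The uniform (equidistributed) probability measure on the `n`-periodic points of `f`,
`μ_n = |Per_n(f)|⁻¹ ∑_{x ∈ Per_n(f)} δ_x`. -/
noncomputable def perMeasure [MeasurableSpace X] (f : X → X) (n : ℕ) : Measure X :=
  ProbabilityTheory.uniformOn (perSet f n)

/-- The uniform probability measure on a set `s`,
`|s|⁻¹ ∑_{x ∈ s} δ_x`. -/
noncomputable def unifMeasure [MeasurableSpace X] (s : Set X) : Measure X :=
  ProbabilityTheory.uniformOn s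

/-- Weak* convergence of a sequence of measures against continuous test functions. -/
def WeakLimit [TopologicalSpace X] [MeasurableSpace X] (μs : ℕ → Measure X) (ν : Measure X) :
    Prop :=
  ∀ φ : C(X, ℝ), Tendsto (fun n => ∫ x, φ x ∂(μs n)) atTop (𝓝 (∫ x, φ x ∂ν))

/-- `ν` is a weak* accumulation point of the sequence `μs`. -/
def WeakClusterPt [TopologicalSpace X] [MeasurableSpace X] (μs : ℕ → Measure X)
    (ν : Measure X) : Prop :=
  ∃ u : ℕ → ℕ, StrictMono u ∧ WeakLimit (μs ∘ u) ν

/-- `E` is `(n,ε)`-separated for `g`. -/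
def IsSep [PseudoMetricSpace X] (g : X → X) (n : ℕ) (ε : ℝ) (E : Set X) : Prop :=
  E.Pairwise fun x y => ∃ j < n, ε < dist (g^[j] x) (g^[j] y)

/-- Maximal cardinality of an `(n,ε)`-separated subset of `K` for `g`. -/
noncomputable def sepCard [PseudoMetricSpace X] (g : X → X) (K : Set X) (n : ℕ) (ε : ℝ) :
    ℝ≥0∞ :=
  ⨆ (E : Finset X) (_ : ↑E ⊆ K ∧ IsSep g n ε ↑E), (E.card : ℝ≥0∞)

/-- Topological entropy of `g` relative to the set `K`:
`h_top(g,K) = lim_{ε→0} limsup_n (1/n) log E_K(n,ε)`; since the inner quantity is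
monotone in `ε`, the limit as `ε → 0` is the supremum over `ε > 0`. -/
noncomputable def relEntropy [PseudoMetricSpace X] (g : X → X) (K : Set X) : EReal :=
  ⨆ (ε : ℝ) (_ : 0 < ε),
    Filter.limsup (fun n : ℕ => ENNReal.log (sepCard g K n ε) / (n : EReal)) atTop

/-- Topological entropy of `g`. -/
noncomputable def topEntropy [PseudoMetricSpace X] (g : X → X) : EReal :=
  relEntropy g Set.univ

/-- A finite measurable partition of `X`. -/
def IsMPartition [MeasurableSpace X] (P : Finset (Set X)) : Prop :=
  (∀ A ∈ P, MeasurableSet A) ∧ ((P : Set (Set X)).PairwiseDisjoint id) ∧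
    ⋃₀ (P : Set (Set X)) = Set.univ

/-- The entropy `H_μ(P ∨ g⁻¹P ∨ ⋯ ∨ g^{-(n-1)}P)` of the `n`-th dynamical refinement of the
partition `P`. -/
noncomputable def dynH [MeasurableSpace X] (μ : Measure X) (g : X → X) (P : Finset (Set X))
    (n : ℕ) : ℝ :=
  ∑ A : Fin n → ↥P, Real.negMulLog (μ (⋂ i : Fin n, g^[i.1] ⁻¹' ((A i : Set X)))).toReal

/-- The measure-theoretic (Kolmogorov–Sinai) entropy `h_μ(g)`, using that for invariant `μ`
the limit `lim_n H_n/n` equals `inf_n H_n/n` by subadditivity. -/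
noncomputable def mEntropy [MeasurableSpace X] (g : X → X) (μ : Measure X) : EReal :=
  ⨆ P : {P : Finset (Set X) // IsMPartition P},
    ⨅ n : ℕ, ((dynH μ g (P : Finset (Set X)) (n + 1) / (n + 1) : ℝ) : EReal)

section Hyp

variable [MetricSpace X] [CompactSpace X] [MeasurableSpace X] [BorelSpace X]

/-- Hypothesis (H1): every class `[x] = h⁻¹(h x)` has zero relative topological entropy. -/
def HypH1 (g h : X → X) : Prop :=
  ∀ x : X, relEntropy g (h ⁻¹' {h x}) = 0

/-- Hypothesis (H2): every periodic class contains a `g`-periodic point whose `g`-period is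
the `f`-period of `h x`. -/
def HypH2 (f g h : X → X) : Prop :=
  ∀ x : X, h x ∈ Function.periodicPts f →
    ∃ y : X, h y = h x ∧ Function.minimalPeriod g y = Function.minimalPeriod f (h x)

/-- Hypothesis (H3): the set of points whose class is trivial has full Bowen measure. -/
def HypH3 (h : X → X) (μ : Measure X) : Prop :=
  μ {y : X | ∃ x : X, h ⁻¹' {y} = {x}} = 1

/-- `P` is an admissible choice of the sets `P̃er_n(g)`: `P n` consists of `g`-periodic points
of period `n` lying over `Per_n(f)`, and `h` maps `P n` bijectively onto `Per_n(f)`. -/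
def IsPerSelection (f g h : X → X) (P : ℕ → Set X) : Prop :=
  ∀ n : ℕ, P n ⊆ perSet g n ∧ (∀ x ∈ P n, g x ∈ P n) ∧ Set.BijOn h (P n) (perSet f n)

end Hyp

end Samva

open Samva

open MeasureTheory Filter Topology Set
open scoped ENNReal NNReal
open Samva

namespace Blow

section Ent

variable {Ω : Type*} [MeasurableSpace Ω]

/-- Entropy of a finite valued function. -/
noncomputable def HH {ι : Type*} [Fintype ι] (ν : Measure Ω) (X : Ω → ι) : ℝ :=
  ∑ a, Real.negMulLog (ν.real (X ⁻¹' {a}))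

/-- All fibres are measurable. -/
def MF {ι : Type*} (X : Ω → ι) : Prop := ∀ a, MeasurableSet (X ⁻¹' {a})

lemma MF.preimage {ι : Type*} [Finite ι] {X : Ω → ι} (hX : MF X) (s : Set ι) :
    MeasurableSet (X ⁻¹' s) := by
  have : X ⁻¹' s = ⋃ a ∈ s, X ⁻¹' {a} := by ext; simp
  rw [this]
  exact MeasurableSet.biUnion s.to_countable (fun a _ => hX a)

lemma MF.comp {ι κ : Type*} [Finite ι] {X : Ω → ι} (hX : MF X) (φ : ι → κ) : MF (φ ∘ X) := by
  intro b
  rw [preimage_comp]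
  exact hX.preimage _

lemma MF.prodMk {ι κ : Type*} {X : Ω → ι} {Y : Ω → κ} (hX : MF X) (hY : MF Y) :
    MF (fun ω => (X ω, Y ω)) := by
  rintro ⟨a, b⟩
  have : (fun ω => (X ω, Y ω)) ⁻¹' {(a, b)} = X ⁻¹' {a} ∩ Y ⁻¹' {b} := by
    ext; simp
  rw [this]
  exact (hX a).inter (hY b)

lemma MF.pi {ι κ : Type*} [Finite κ] {X : κ → Ω → ι} (hX : ∀ i, MF (X i)) :
    MF (fun ω i => X i ω) := by
  intro a
  have : (fun ω i => X i ω) ⁻¹' {a} = ⋂ i, X i ⁻¹' {a i} := by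
    ext; simp [funext_iff]
  rw [this]
  exact MeasurableSet.iInter fun i => hX i _

lemma MF.comp_meas {ι : Type*} {X : Ω → ι} (hX : MF X) {g : Ω → Ω} (hg : Measurable g) :
    MF (X ∘ g) := fun a => hg (hX a)

/-- pointwise Gibbs inequality -/
lemma gibbs_pt {p t : ℝ} (hp : 0 ≤ p) (ht : 0 ≤ t) (h : t = 0 → p = 0) :
    Real.negMulLog p ≤ -(p * Real.log t) + t - p := by
  rcases hp.eq_or_lt with rfl | hp
  · simp [ht]
  have ht' : 0 < t := lt_of_le_of_ne ht (fun e => hp.ne' (h e.symm))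
  have h1 := Real.log_le_sub_one_of_pos (div_pos ht' hp)
  rw [Real.log_div ht'.ne' hp.ne'] at h1
  have h2 := mul_le_mul_of_nonneg_left h1 hp.le
  have h3 : p * (t / p - 1) = t - p := by field_simp
  rw [h3] at h2
  unfold Real.negMulLog
  nlinarith

/-- Lemma J -/
lemma sum_negMulLog_le {ι : Type*} (S : Finset ι) (p : ι → ℝ) (hp : ∀ i ∈ S, 0 ≤ p i)
    {c : ℝ} (hc : 0 < c) (hS : (S.card : ℝ) ≤ c) :
    ∑ i ∈ S, Real.negMulLog (p i) ≤
      Real.negMulLog (∑ i ∈ S, p i) + (∑ i ∈ S, p i) * Real.log c := by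
  set q := ∑ i ∈ S, p i with hq
  have hq0 : 0 ≤ q := Finset.sum_nonneg hp
  rcases hq0.eq_or_lt with h0 | h0
  · have : ∀ i ∈ S, p i = 0 := (Finset.sum_eq_zero_iff_of_nonneg hp).1 h0.symm
    rw [← h0, Finset.sum_eq_zero (fun i hi => by simp [this i hi])]
    simp
  have ht : 0 < q / c := div_pos h0 hc
  calc ∑ i ∈ S, Real.negMulLog (p i) ≤ ∑ i ∈ S, (-(p i * Real.log (q / c)) + q / c - p i) :=
        Finset.sum_le_sum fun i hi => gibbs_pt (hp i hi) ht.le (fun e => absurd e ht.ne')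
    _ = -(q * Real.log (q / c)) + S.card * (q / c) - q := by
        rw [Finset.sum_sub_distrib, Finset.sum_add_distrib, Finset.sum_neg_distrib,
          ← Finset.sum_mul]
        simp [hq]
    _ ≤ -(q * Real.log (q / c)) + c * (q / c) - q := by gcongr
    _ = _ := by
        rw [Real.log_div h0.ne' hc.ne', mul_div_cancel₀ _ hc.ne']
        unfold Real.negMulLog; ring

lemma negMulLog_sum_le {ι : Type*} (S : Finset ι) (p : ι → ℝ) (hp : ∀ i ∈ S, 0 ≤ p i) :
    Real.negMulLog (∑ i ∈ S, p i) ≤ ∑ i ∈ S, Real.negMulLog (p i) := by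
  have : Real.negMulLog (∑ i ∈ S, p i) = ∑ i ∈ S, -(p i * Real.log (∑ i ∈ S, p i)) := by
    rw [Finset.sum_neg_distrib, ← Finset.sum_mul]; unfold Real.negMulLog; ring
  rw [this]
  refine Finset.sum_le_sum fun i hi => ?_
  rcases (hp i hi).eq_or_lt with h | h
  · simp [← h]
  · have h1 : p i ≤ ∑ i ∈ S, p i := Finset.single_le_sum hp hi
    have := Real.log_le_log h h1
    unfold Real.negMulLog
    nlinarith

variable {ν : Measure Ω} [IsProbabilityMeasure ν]

lemma real_preimage_eq {ι : Type*} [Fintype ι] {X : Ω → ι} (hX : MF X) (s : Finset ι) :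
    ν.real (X ⁻¹' (s : Set ι)) = ∑ a ∈ s, ν.real (X ⁻¹' {a}) := by
  have : X ⁻¹' (s : Set ι) = ⋃ a ∈ s, X ⁻¹' {a} := by ext; simp
  rw [this]
  refine measureReal_biUnion_finset ?_ (fun a _ => hX a)
  intro a _ b _ hab
  exact Disjoint.preimage _ (by simpa using hab)

lemma sum_real_preimage {ι : Type*} [Fintype ι] {X : Ω → ι} (hX : MF X) :
    ∑ a, ν.real (X ⁻¹' {a}) = 1 := by
  rw [← real_preimage_eq hX]; simp

lemma HH_comp_le {ι κ : Type*} [Fintype ι] [Fintype κ] {X : Ω → ι} (hX : MF X) (φ : ι → κ) :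
    HH ν (φ ∘ X) ≤ HH ν X := by
  classical
  unfold HH
  rw [← Finset.sum_fiberwise (s := Finset.univ) (g := φ)]
  refine Finset.sum_le_sum fun b _ => ?_
  have : (φ ∘ X) ⁻¹' {b} = X ⁻¹' ((Finset.univ.filter (fun a => φ a = b) : Finset ι) : Set ι) := by
    ext; simp
  rw [this, real_preimage_eq hX]
  exact negMulLog_sum_le _ _ (fun _ _ => measureReal_nonneg)

lemma HH_prod_le {ι κ : Type*} [Fintype ι] [Fintype κ] {X : Ω → ι} {Y : Ω → κ}
    (hX : MF X) (hY : MF Y) : HH ν (fun ω => (X ω, Y ω)) ≤ HH ν X + HH ν Y := by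
  classical
  have hXY := hX.prodMk hY
  set r : ι × κ → ℝ := fun ab => ν.real ((fun ω => (X ω, Y ω)) ⁻¹' {ab}) with hr
  have hr0 : ∀ ab, 0 ≤ r ab := fun _ => measureReal_nonneg
  have hx : ∀ a, ν.real (X ⁻¹' {a}) = ∑ b, r (a, b) := by
    intro a
    have : X ⁻¹' {a} = (fun ω => (X ω, Y ω)) ⁻¹'
      ((Finset.univ.image (fun b : κ => (a, b)) : Finset (ι × κ)) : Set (ι × κ)) := by
      ext; simp [eq_comm]
    rw [this, real_preimage_eq hXY, Finset.sum_image (by intro x _ y _ h; simpa using h)]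
  have hy : ∀ b, ν.real (Y ⁻¹' {b}) = ∑ a, r (a, b) := by
    intro b
    have : Y ⁻¹' {b} = (fun ω => (X ω, Y ω)) ⁻¹'
      ((Finset.univ.image (fun a : ι => (a, b)) : Finset (ι × κ)) : Set (ι × κ)) := by
      ext; simp [eq_comm]
    rw [this, real_preimage_eq hXY, Finset.sum_image (by intro x _ y _ h; simpa using h)]
  have s1 := sum_real_preimage (ν := ν) hX
  have s2 := sum_real_preimage (ν := ν) hY
  have s3 := sum_real_preimage (ν := ν) hXY
  set p : ι → ℝ := fun a => ν.real (X ⁻¹' {a})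
  set q : κ → ℝ := fun b => ν.real (Y ⁻¹' {b})
  have hp0 : ∀ a, 0 ≤ p a := fun _ => measureReal_nonneg
  have hq0 : ∀ a, 0 ≤ q a := fun _ => measureReal_nonneg
  have hrp : ∀ a b, r (a, b) ≤ p a := fun a b => by
    change _ ≤ ν.real _; rw [hx]
    exact Finset.single_le_sum (f := fun b => r (a, b)) (fun b _ => hr0 _) (Finset.mem_univ b)
  have hrq : ∀ a b, r (a, b) ≤ q b := fun a b => by
    change _ ≤ ν.real _; rw [hy]
    exact Finset.single_le_sum (f := fun a => r (a, b)) (fun b _ => hr0 _) (Finset.mem_univ a)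
  have key : ∀ ab : ι × κ, Real.negMulLog (r ab) ≤
      -(r ab * Real.log (p ab.1)) - (r ab * Real.log (q ab.2)) + p ab.1 * q ab.2 - r ab := by
    rintro ⟨a, b⟩
    have h1 := gibbs_pt (hr0 (a, b)) (mul_nonneg (hp0 a) (hq0 b)) (by
      intro h
      rcases mul_eq_zero.1 h with h | h
      · exact le_antisymm (h ▸ hrp a b) (hr0 _)
      · exact le_antisymm (h ▸ hrq a b) (hr0 _))
    rcases eq_or_ne (p a) 0 with h | h
    · have : r (a, b) = 0 := le_antisymm (h ▸ hrp a b) (hr0 _)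
      simp [this, h]
    rcases eq_or_ne (q b) 0 with h' | h'
    · have : r (a, b) = 0 := le_antisymm (h' ▸ hrq a b) (hr0 _)
      simp [this, h']
    rw [Real.log_mul h h'] at h1
    simp only
    linarith
  calc HH ν (fun ω => (X ω, Y ω)) ≤ ∑ ab : ι × κ, (-(r ab * Real.log (p ab.1)) -
        (r ab * Real.log (q ab.2)) + p ab.1 * q ab.2 - r ab) :=
        Finset.sum_le_sum fun ab _ => key ab
    _ = HH ν X + HH ν Y := by
        rw [Finset.sum_sub_distrib, Finset.sum_add_distrib, Finset.sum_sub_distrib, s3]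
        have e1 : ∑ ab : ι × κ, -(r ab * Real.log (p ab.1)) = HH ν X := by
          rw [Fintype.sum_prod_type]
          unfold HH
          refine Finset.sum_congr rfl fun a _ => ?_
          simp only [Finset.sum_neg_distrib, ← Finset.sum_mul, ← hx]
          unfold Real.negMulLog; ring
        have e2 : ∑ ab : ι × κ, (r ab * Real.log (q ab.2)) = - HH ν Y := by
          rw [Fintype.sum_prod_type_right]
          unfold HH
          rw [← Finset.sum_neg_distrib]
          refine Finset.sum_congr rfl fun a _ => ?_
          simp only [← Finset.sum_mul, ← hy]
          unfold Real.negMulLog; ring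
        have e3 : ∑ ab : ι × κ, p ab.1 * q ab.2 = 1 := by
          rw [Fintype.sum_prod_type]
          simp only [← Finset.mul_sum, s2, mul_one, s1]
        rw [e1, e2, e3]; ring

lemma HH_nonneg {ι : Type*} [Fintype ι] (X : Ω → ι) : 0 ≤ HH ν X :=
  Finset.sum_nonneg fun _ _ => Real.negMulLog_nonneg measureReal_nonneg measureReal_le_one

lemma HH_pi_le {ι : Type*} [Fintype ι] (N : ℕ) (X : Fin N → Ω → ι) (hX : ∀ i, MF (X i)) :
    HH ν (fun ω i => X i ω) ≤ ∑ i, HH ν (X i) := by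
  induction N with
  | zero =>
    have : HH ν (fun ω (i : Fin 0) => X i ω) ≤ 0 := by
      unfold HH
      refine Finset.sum_nonpos fun a _ => ?_
      have : (fun ω (i : Fin 0) => X i ω) ⁻¹' {a} = univ := by
        ext; simp [eq_iff_true_of_subsingleton]
      simp [this]
    simpa using this
  | succ N ih =>
    rw [Fin.sum_univ_succ]
    have h1 := ih (fun i => X i.succ) (fun i => hX _)
    have h2 := HH_prod_le (ν := ν) (hX 0) (MF.pi (fun i : Fin N => hX i.succ))
    have h3 := HH_comp_le (ν := ν) ((hX 0).prodMk (MF.pi (fun i : Fin N => hX i.succ)))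
      (fun ab : ι × (Fin N → ι) => (Fin.cons ab.1 ab.2 : Fin (N + 1) → ι))
    have h4 : ((fun ab : ι × (Fin N → ι) => (Fin.cons ab.1 ab.2 : Fin (N + 1) → ι)) ∘
      fun ω => (X 0 ω, fun i => X i.succ ω)) = (fun ω i => X i ω) := by
      funext ω i
      refine Fin.cases ?_ (fun j => ?_) i <;> simp
    rw [h4] at h3
    linarith

/-- conditional counting bound -/
lemma HH_prod_count {ι κ : Type*} [Fintype ι] [Fintype κ] {X : Ω → ι} {Y : Ω → κ}
    (hX : MF X) (hY : MF Y) {c : ℝ} (hc : 0 < c)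
    (hcount : ∀ b (S : Finset ι), (∀ a ∈ S, ∃ ω, X ω = a ∧ Y ω = b) → (S.card : ℝ) ≤ c) :
    HH ν X ≤ HH ν Y + Real.log c := by
  classical
  have hXY := hX.prodMk hY
  set r : ι × κ → ℝ := fun ab => ν.real ((fun ω => (X ω, Y ω)) ⁻¹' {ab}) with hr
  have hr0 : ∀ ab, 0 ≤ r ab := fun _ => measureReal_nonneg
  have hy : ∀ b, ν.real (Y ⁻¹' {b}) = ∑ a, r (a, b) := by
    intro b
    have : Y ⁻¹' {b} = (fun ω => (X ω, Y ω)) ⁻¹'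
      ((Finset.univ.image (fun a : ι => (a, b)) : Finset (ι × κ)) : Set (ι × κ)) := by
      ext; simp [eq_comm]
    rw [this, real_preimage_eq hXY, Finset.sum_image (by intro x _ y _ h; simpa using h)]
  have h1 : HH ν X ≤ HH ν (fun ω => (X ω, Y ω)) := by
    have := HH_comp_le (ν := ν) hXY Prod.fst
    exact this
  refine h1.trans ?_
  have h2 : HH ν (fun ω => (X ω, Y ω)) = ∑ b, ∑ a, Real.negMulLog (r (a, b)) := by
    unfold HH; rw [Fintype.sum_prod_type_right]
  rw [h2]
  have h3 : ∀ b, ∑ a, Real.negMulLog (r (a, b)) ≤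
      Real.negMulLog (ν.real (Y ⁻¹' {b})) + ν.real (Y ⁻¹' {b}) * Real.log c := by
    intro b
    set S : Finset ι := Finset.univ.filter (fun a => ∃ ω, X ω = a ∧ Y ω = b)
    have hz : ∀ a, a ∉ S → r (a, b) = 0 := by
      intro a ha
      have : (fun ω => (X ω, Y ω)) ⁻¹' {(a, b)} = ∅ := by
        ext ω
        simp only [mem_preimage, mem_singleton_iff, Prod.mk.injEq, mem_empty_iff_false, iff_false]
        intro h; exact ha (by simp [S]; exact ⟨ω, h⟩)
      simp [hr, this]
    have e1 : ∑ a, Real.negMulLog (r (a, b)) = ∑ a ∈ S, Real.negMulLog (r (a, b)) :=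
      (Finset.sum_subset (Finset.subset_univ _) (fun a _ ha => by simp [hz a ha])).symm
    have e2 : ν.real (Y ⁻¹' {b}) = ∑ a ∈ S, r (a, b) := by
      rw [hy]
      exact (Finset.sum_subset (Finset.subset_univ _) (fun a _ ha => by simp [hz a ha])).symm
    rw [e1, e2]
    exact sum_negMulLog_le S _ (fun _ _ => hr0 _) hc (hcount b S (by simp [S]))
  refine (Finset.sum_le_sum fun b _ => h3 b).trans ?_
  rw [Finset.sum_add_distrib, ← Finset.sum_mul, sum_real_preimage hY, one_mul]
  rfl

lemma HH_le_log {ι : Type*} [Fintype ι] {X : Ω → ι} (hX : MF X) {c : ℝ} (hc : 0 < c)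
    (h : (Fintype.card ι : ℝ) ≤ c) : HH ν X ≤ Real.log c := by
  have := sum_negMulLog_le Finset.univ (fun a => ν.real (X ⁻¹' {a})) (fun _ _ => measureReal_nonneg)
    hc (by simpa using h)
  rw [sum_real_preimage hX] at this
  unfold HH
  simpa using this

lemma HH_comp_meas {ι : Type*} [Fintype ι] {X : Ω → ι} (hX : MF X) {g : Ω → Ω}
    (hg : MeasurePreserving g ν ν) : HH ν (X ∘ g) = HH ν X := by
  unfold HH
  refine Finset.sum_congr rfl fun a _ => ?_
  rw [preimage_comp, measureReal_def, measureReal_def, hg.measure_preimage (hX a).nullMeasurableSet]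

/-- lower bound from small cells -/
lemma le_HH {ι : Type*} [Fintype ι] {X : Ω → ι} (hX : MF X) {t : ℝ}
    (h : ∀ a, ν.real (X ⁻¹' {a}) ≤ t) : -Real.log t ≤ HH ν X := by
  have : -Real.log t = ∑ a, -(ν.real (X ⁻¹' {a}) * Real.log t) := by
    rw [Finset.sum_neg_distrib, ← Finset.sum_mul, sum_real_preimage hX, one_mul]
  rw [this]
  refine Finset.sum_le_sum fun a _ => ?_
  rcases (measureReal_nonneg (μ := ν) (s := X ⁻¹' {a})).eq_or_lt with h0 | h0
  · simp [← h0]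
  · have := Real.log_le_log h0 (h a)
    unfold Real.negMulLog
    nlinarith

end Ent

end Blow

open MeasureTheory Filter Topology Set
open scoped ENNReal NNReal
open Samva

namespace Blow

section Sep

variable {X : Type*} [MetricSpace X]

/-- Closed Bowen closeness. -/
def BC (T : X → X) (n : ℕ) (ε : ℝ) (x y : X) : Prop :=
  ∀ j < n, dist (T^[j] x) (T^[j] y) ≤ ε

lemma BC.symm {T : X → X} {n : ℕ} {ε : ℝ} {x y : X} (h : BC T n ε x y) : BC T n ε y x :=
  fun j hj => by rw [dist_comm]; exact h j hj

lemma BC.trans {T : X → X} {n : ℕ} {ε ε' : ℝ} {x y z : X} (h : BC T n ε x y)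
    (h' : BC T n ε' y z) : BC T n (ε + ε') x z :=
  fun j hj => (dist_triangle _ _ _).trans (add_le_add (h j hj) (h' j hj))

lemma BC.mono {T : X → X} {n : ℕ} {ε ε' : ℝ} {x y : X} (h : BC T n ε x y) (he : ε ≤ ε') :
    BC T n ε' x y := fun j hj => (h j hj).trans he

lemma BC.refl {T : X → X} {n : ℕ} {ε : ℝ} (hε : 0 ≤ ε) (x : X) : BC T n ε x x :=
  fun j _ => by simpa using hε

lemma isSep_iff {T : X → X} {n : ℕ} {ε : ℝ} {E : Set X} :
    IsSep T n ε E ↔ ∀ x ∈ E, ∀ y ∈ E, BC T n ε x y → x = y := by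
  constructor
  · intro h x hx y hy hb
    by_contra hne
    obtain ⟨j, hj, hd⟩ := h hx hy hne
    exact absurd (hb j hj) (not_le.2 hd)
  · intro h x hx y hy hne
    by_contra hcon
    push Not at hcon
    exact hne (h x hx y hy hcon)

lemma card_fiber_le {κ : Type*} (E : Finset X) (t : Finset κ) (φ : X → κ)
    (hφ : ∀ x ∈ E, φ x ∈ t) {c : ℝ}
    (hc : ∀ b ∈ t, ∀ F : Finset X, F ⊆ E → (∀ x ∈ F, φ x = b) → (F.card : ℝ) ≤ c) :
    (E.card : ℝ) ≤ t.card * c := by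
  classical
  rw [Finset.card_eq_sum_card_fiberwise (f := φ) (t := t) (fun x hx => hφ x hx)]
  push_cast
  calc ∑ b ∈ t, ((E.filter (fun a => φ a = b)).card : ℝ) ≤ ∑ b ∈ t, c :=
        Finset.sum_le_sum fun b hb => hc b hb _ (Finset.filter_subset _ _) (by simp)
    _ = t.card * c := by simp

lemma card_le_one_of {E : Finset X} (h : ∀ x ∈ E, ∀ y ∈ E, x = y) : (E.card : ℝ) ≤ 1 := by
  have : E.card ≤ 1 := Finset.card_le_one.2 h
  exact_mod_cast this

variable [CompactSpace X]

lemma exists_cover {T : X → X} (hT : Continuous T) (n : ℕ) {ε : ℝ} (hε : 0 < ε) :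
    ∃ t : Finset X, ∀ x, ∃ e ∈ t, ∀ j < n, dist (T^[j] x) (T^[j] e) < ε := by
  have hop : ∀ e : X, IsOpen {x | ∀ j < n, dist (T^[j] x) (T^[j] e) < ε} := by
    intro e
    have : {x | ∀ j < n, dist (T^[j] x) (T^[j] e) < ε} =
        ⋂ j ∈ Finset.range n, {x | dist (T^[j] x) (T^[j] e) < ε} := by
      ext; simp
    rw [this]
    exact isOpen_biInter_finset fun j _ =>
      isOpen_lt ((hT.iterate j).dist continuous_const) continuous_const
  obtain ⟨t, -, ht⟩ := isCompact_univ.elim_nhds_subcover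
    (fun e => {x | ∀ j < n, dist (T^[j] x) (T^[j] e) < ε})
    (fun e _ => (hop e).mem_nhds (by simp [hε]))
  refine ⟨t, fun x => ?_⟩
  have := ht (mem_univ x)
  simpa using this

lemma sep_bdd {T : X → X} (hT : Continuous T) (n : ℕ) {ε : ℝ} (hε : 0 < ε) :
    ∃ L : ℕ, ∀ E : Finset X, IsSep T n ε (E : Set X) → E.card ≤ L := by
  classical
  obtain ⟨t, ht⟩ := exists_cover hT n (half_pos hε)
  choose φ h1 h2 using ht
  refine ⟨t.card, fun E hE => ?_⟩
  have := card_fiber_le E t φ (fun x _ => h1 x) (c := 1) (by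
    intro b _ F hF hb
    refine card_le_one_of fun x hx y hy => ?_
    refine isSep_iff.1 hE x (hF hx) y (hF hy) fun j hj => ?_
    have a1 := h2 x j hj
    have a2 := h2 y j hj
    rw [hb x hx] at a1
    rw [hb y hy] at a2
    have := dist_triangle_right (T^[j] x) (T^[j] y) (T^[j] b)
    linarith)
  rw [mul_one] at this
  exact_mod_cast this

/-- Maximal cardinality of a separated set, as a natural number. -/
noncomputable def sN (T : X → X) (K : Set X) (n : ℕ) (ε : ℝ) : ℕ :=
  sSup {k | ∃ E : Finset X, (E : Set X) ⊆ K ∧ IsSep T n ε (E : Set X) ∧ E.card = k}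

lemma sN_bdd {T : X → X} (hT : Continuous T) (K : Set X) (n : ℕ) {ε : ℝ} (hε : 0 < ε) :
    BddAbove {k | ∃ E : Finset X, (E : Set X) ⊆ K ∧ IsSep T n ε (E : Set X) ∧ E.card = k} := by
  obtain ⟨L, hL⟩ := sep_bdd hT n hε
  exact ⟨L, by rintro k ⟨E, -, h, rfl⟩; exact hL E h⟩

lemma le_sN {T : X → X} (hT : Continuous T) {K : Set X} {n : ℕ} {ε : ℝ} (hε : 0 < ε)
    {E : Finset X} (hEK : (E : Set X) ⊆ K) (hE : IsSep T n ε (E : Set X)) :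
    E.card ≤ sN T K n ε :=
  le_csSup (sN_bdd hT K n hε) ⟨E, hEK, hE, rfl⟩

lemma exists_sN {T : X → X} (hT : Continuous T) (K : Set X) (n : ℕ) {ε : ℝ} (hε : 0 < ε) :
    ∃ E : Finset X, (E : Set X) ⊆ K ∧ IsSep T n ε (E : Set X) ∧ E.card = sN T K n ε ∧
      ∀ x ∈ K, ∃ e ∈ E, BC T n ε x e := by
  classical
  obtain ⟨E, h1, h2, h3⟩ := Nat.sSup_mem
    (s := {k | ∃ E : Finset X, (E : Set X) ⊆ K ∧ IsSep T n ε (E : Set X) ∧ E.card = k})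
    ⟨0, ∅, by simp, by simp [IsSep], by simp⟩ (sN_bdd hT K n hε)
  refine ⟨E, h1, h2, h3, fun x hx => ?_⟩
  by_contra hcon
  push Not at hcon
  have hxE : x ∉ E := fun h => hcon x h (BC.refl hε.le x)
  have h4 : IsSep T n ε ((insert x E : Finset X) : Set X) := by
    rw [isSep_iff] at h2 ⊢
    intro a ha b hb hab
    simp only [Finset.coe_insert, mem_insert_iff, Finset.mem_coe] at ha hb
    rcases ha with rfl | ha <;> rcases hb with rfl | hb
    · rfl
    · exact absurd hab (hcon b hb)
    · exact absurd hab.symm (hcon a ha)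
    · exact h2 a ha b hb hab
  have h5 := le_sN hT (K := K) hε (by
    simp only [Finset.coe_insert]; exact insert_subset hx h1) h4
  rw [Finset.card_insert_of_notMem hxE, h3] at h5
  unfold sN at h5
  omega

lemma sepCard_eq {T : X → X} (hT : Continuous T) (K : Set X) (n : ℕ) {ε : ℝ} (hε : 0 < ε) :
    sepCard T K n ε = (sN T K n ε : ℝ≥0∞) := by
  unfold sepCard
  apply le_antisymm
  · refine iSup_le fun E => iSup_le fun hE => ?_
    exact_mod_cast le_sN hT hε hE.1 hE.2
  · obtain ⟨E, h1, h2, h3, -⟩ := exists_sN hT K n hε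
    rw [← h3]
    exact le_iSup₂_of_le E ⟨h1, h2⟩ le_rfl

lemma sN_pos {T : X → X} (hT : Continuous T) {K : Set X} (hK : K.Nonempty) (n : ℕ) {ε : ℝ}
    (hε : 0 < ε) : 1 ≤ sN T K n ε := by
  obtain ⟨x, hx⟩ := hK
  have := le_sN hT (K := K) (n := n) hε (E := {x}) (by simpa using hx) (by simp [IsSep])
  simpa using this

lemma sN_submul {T : X → X} (hT : Continuous T) (n m : ℕ) {ε : ℝ} (hε : 0 < ε) :
    sN T univ (n + m) (2 * ε) ≤ sN T univ n ε * sN T univ m ε := by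
  classical
  obtain ⟨E, -, h2, h3, -⟩ := exists_sN hT univ (n + m) (ε := 2 * ε) (by linarith)
  obtain ⟨A, -, -, a3, a4⟩ := exists_sN hT univ n hε
  obtain ⟨B, -, -, b3, b4⟩ := exists_sN hT univ m hε
  choose! φ p1 p2 using a4
  choose! ψ q1 q2 using b4
  have := card_fiber_le E (A ×ˢ B) (fun x => (φ x, ψ (T^[n] x)))
    (fun x _ => Finset.mem_product.2 ⟨p1 _ (mem_univ _), q1 _ (mem_univ _)⟩) (c := 1) (by
    rintro ⟨a, b⟩ _ F hF hb
    refine card_le_one_of fun x hx y hy => ?_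
    refine isSep_iff.1 h2 x (hF hx) y (hF hy) fun j hj => ?_
    have hx' := hb x hx
    have hy' := hb y hy
    simp only [Prod.mk.injEq] at hx' hy'
    rcases lt_or_ge j n with hjn | hjn
    · have := (p2 x (mem_univ _)).trans ((hx'.1.trans hy'.1.symm) ▸ (p2 y (mem_univ _)).symm) j hjn
      linarith
    · have := (q2 (T^[n] x) (mem_univ _)).trans
        ((hx'.2.trans hy'.2.symm) ▸ (q2 (T^[n] y) (mem_univ _)).symm) (j - n) (by omega)
      rw [← Function.iterate_add_apply, ← Function.iterate_add_apply, Nat.sub_add_cancel hjn] at this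
      linarith)
  rw [mul_one, Finset.card_product, h3, a3, b3] at this
  exact_mod_cast this

end Sep

section Exp

variable {X : Type*} [MetricSpace X]

lemma zIter_eq (f : X ≃ₜ X) (n : ℤ) (x : X) : zIter f n x = (f ^ n) x := by
  have key : ∀ (g : X ≃ₜ X) (n : ℕ), (g : X → X)^[n] = ⇑(g ^ n) := by
    intro g n
    induction n with
    | zero => rfl
    | succ n ih => rw [Function.iterate_succ, ih, pow_succ]; rfl
  cases n with
  | ofNat n => simp only [zIter, key, Int.ofNat_eq_natCast, zpow_natCast]
  | negSucc n =>
    simp only [zIter, key, zpow_negSucc]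
    rw [← inv_pow]; rfl

lemma zIter_nat (f : X ≃ₜ X) (n : ℕ) (x : X) : zIter f n x = f^[n] x := rfl

lemma zIter_add (f : X ≃ₜ X) (a b : ℤ) (x : X) : zIter f (a + b) x = zIter f a (zIter f b x) := by
  simp only [zIter_eq, zpow_add]; rfl

lemma zIter_cont (f : X ≃ₜ X) (a : ℤ) : Continuous (zIter f a) := by
  have : zIter f a = ⇑(f ^ a) := by funext x; exact zIter_eq f a x
  rw [this]; exact (f ^ a).continuous

variable [CompactSpace X]

lemma unif_exp {f : X ≃ₜ X} {α : ℝ} (hα : IsExpansiveWith f α) {δ : ℝ} (hδ : 0 < δ) :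
    ∃ k : ℕ, ∀ x y, (∀ i : ℤ, |i| ≤ k → dist (zIter f i x) (zIter f i y) ≤ α) → dist x y < δ := by
  by_contra hcon
  push Not at hcon
  let F : ℕ → Set (X × X) := fun k =>
    {q | (∀ i : ℤ, |i| ≤ k → dist (zIter f i q.1) (zIter f i q.2) ≤ α) ∧ δ ≤ dist q.1 q.2}
  have hcl : ∀ k, IsClosed (F k) := by
    intro k
    refine IsClosed.inter ?_ (isClosed_le continuous_const (continuous_fst.dist continuous_snd))
    have : {q : X × X | ∀ i : ℤ, |i| ≤ k → dist (zIter f i q.1) (zIter f i q.2) ≤ α} =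
      ⋂ (i : ℤ) (_ : |i| ≤ k), {q : X × X | dist (zIter f i q.1) (zIter f i q.2) ≤ α} := by
      ext; simp
    change IsClosed {q : X × X | ∀ i : ℤ, |i| ≤ k → dist (zIter f i q.1) (zIter f i q.2) ≤ α}
    rw [this]
    exact isClosed_iInter fun i => isClosed_iInter fun _ =>
      isClosed_le (((zIter_cont f i).comp continuous_fst).dist
        ((zIter_cont f i).comp continuous_snd)) continuous_const
  obtain ⟨q, hq⟩ := IsCompact.nonempty_iInter_of_sequence_nonempty_isCompact_isClosed F
    (fun k q hq => ⟨fun i hi => hq.1 i (hi.trans (by push_cast; linarith)), hq.2⟩)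
    (fun k => by
      obtain ⟨x, y, h1, h2⟩ := hcon k
      exact ⟨(x, y), h1, h2⟩) (hcl 0).isCompact hcl
  rw [mem_iInter] at hq
  have : q.1 = q.2 := hα.2 _ _ fun n => (hq n.natAbs).1 n (by simp)
  have h2 := (hq 0).2
  rw [this, dist_self] at h2
  linarith

lemma unif_exp_fwd {f : X ≃ₜ X} {α : ℝ} (hα : IsExpansiveWith f α) {δ : ℝ} (hδ : 0 < δ) :
    ∃ k : ℕ, ∀ n x y, BC f n α x y → ∀ j, k ≤ j → j + k < n →
      dist (f^[j] x) (f^[j] y) < δ := by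
  obtain ⟨k, hk⟩ := unif_exp hα hδ
  refine ⟨k, fun n x y h j h1 h2 => hk _ _ fun i hi => ?_⟩
  rw [abs_le] at hi
  obtain ⟨l, hl⟩ : ∃ l : ℕ, (l : ℤ) = i + j := ⟨(i + j).toNat, by omega⟩
  rw [← zIter_nat, ← zIter_nat, ← zIter_add, ← zIter_add, ← hl]
  exact h l (by omega)

lemma per_sep {f : X ≃ₜ X} {α : ℝ} (hα : IsExpansiveWith f α) {N : ℕ} (hN : 0 < N) {x y : X}
    (hx : f^[N] x = x) (hy : f^[N] y = y) (h : BC f N α x y) : x = y := by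
  have key : ∀ z, f^[N] z = z → ∀ i : ℤ, zIter f i z = f^[(i % N).toNat] z := by
    intro z hz i
    have h0 : (0 : ℤ) ≤ i % N := Int.emod_nonneg _ (by omega)
    have hm : ∀ c : ℤ, zIter f (N * c) z = z := by
      intro c
      rw [zIter_eq, zpow_mul]
      have h1 : (f ^ (N : ℤ)) z = z := by rw [← zIter_eq]; exact hz
      have h2 : Function.IsFixedPt (f ^ (N : ℤ)) z := h1
      have := Function.IsFixedPt.perm_zpow (e := (f ^ (N : ℤ)).toEquiv) h1 c
      have e : (f ^ (N : ℤ)).toEquiv ^ c = ((f ^ (N : ℤ)) ^ c).toEquiv := by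
        exact (map_zpow (⟨⟨Homeomorph.toEquiv, rfl⟩, fun _ _ => rfl⟩ :
          (X ≃ₜ X) →* Equiv.Perm X) _ _).symm
      rw [e] at this
      exact this
    conv_lhs => rw [← Int.emod_add_mul_ediv i N]
    rw [zIter_add, hm, ← zIter_nat, Int.toNat_of_nonneg h0]
  refine hα.2 x y fun i => ?_
  rw [key x hx, key y hy]
  have h0 : (0 : ℤ) ≤ i % N := Int.emod_nonneg _ (by omega)
  have h1 : i % (N : ℤ) < N := Int.emod_lt_of_pos _ (by omega)
  exact h _ (by omega)

lemma spec3 {f : X ≃ₜ X} (hs : HasSpecification f) {ε : ℝ} (hε : 0 < ε) :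
    ∃ m : ℕ, ∀ (n₁ n₂ n₃ : ℕ) (x₁ x₂ x₃ : X), ∃ z,
      f^[n₁ + m + n₂ + m + n₃ + m] z = z ∧
      (∀ j < n₁, dist (f^[j] z) (f^[j] x₁) ≤ ε) ∧
      (∀ j < n₂, dist (f^[n₁ + m + j] z) (f^[j] x₂) ≤ ε) ∧
      (∀ j < n₃, dist (f^[n₁ + m + n₂ + m + j] z) (f^[j] x₃) ≤ ε) := by
  obtain ⟨m, hm⟩ := hs ε hε
  refine ⟨m, fun n₁ n₂ n₃ x₁ x₂ x₃ => ?_⟩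
  obtain ⟨z, hz, h⟩ := hm 2
    ![x₁, zIter f (-((n₁ + m : ℕ) : ℤ)) x₂, zIter f (-((n₁ + m + n₂ + m : ℕ) : ℤ)) x₃]
    ![0, ((n₁ + m : ℕ) : ℤ), ((n₁ + m + n₂ + m : ℕ) : ℤ)]
    ![((n₁ - 1 : ℕ) : ℤ), ((n₁ + m + (n₂ - 1) : ℕ) : ℤ), ((n₁ + m + n₂ + m + (n₃ - 1) : ℕ) : ℤ)]
    (by intro i; fin_cases i <;> simp)
    (by intro i; fin_cases i <;> simp <;> omega)
    ((n₁ + m + n₂ + m + n₃ + m : ℕ) : ℤ)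
    (by simp [Fin.last]; omega)
  refine ⟨z, hz, fun j hj => ?_, fun j hj => ?_, fun j hj => ?_⟩
  · exact h 0 j (by simp) (by simp; omega)
  · have := h 1 ((n₁ + m + j : ℕ) : ℤ) (by simp) (by simp; omega)
    simp only [Matrix.cons_val_one, Matrix.cons_val_zero] at this
    rw [← zIter_add, show ((n₁ + m + j : ℕ) : ℤ) + -((n₁ + m : ℕ) : ℤ) = (j : ℕ) by push_cast; ring]
      at this
    exact this
  · have := h 2 ((n₁ + m + n₂ + m + j : ℕ) : ℤ) (by simp) (by simp; omega)
    simp only [Matrix.cons_val] at this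
    rw [← zIter_add, show ((n₁ + m + n₂ + m + j : ℕ) : ℤ) + -((n₁ + m + n₂ + m : ℕ) : ℤ) = (j : ℕ)
      by push_cast; ring] at this
    exact this

end Exp

end Blow

open MeasureTheory Filter Topology Set
open scoped ENNReal NNReal
open Samva

namespace Blow

lemma almost_mult {a : ℕ → ℝ} (ha : ∀ n, 1 ≤ a n) {K : ℝ} (hK : 1 ≤ K)
    (h1 : ∀ n m, a (n + m) ≤ K * (a n * a m)) (h2 : ∀ n m, a n * a m ≤ K * a (n + m)) :
    ∃ h : ℝ, ∀ n : ℕ, Real.exp (n * h) ≤ K * a n ∧ a n ≤ K * Real.exp (n * h) := by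
  have hK0 : 0 < K := by linarith
  have ha0 : ∀ n, 0 < a n := fun n => by linarith [ha n]
  have hla : ∀ n, 0 ≤ Real.log (a n) := fun n => Real.log_nonneg (ha n)
  have hlK : 0 ≤ Real.log K := Real.log_nonneg hK
  have hu : Subadditive (fun n => Real.log K + Real.log (a n)) := by
    intro n m
    have := Real.log_le_log (ha0 _) (h1 n m)
    rw [Real.log_mul hK0.ne' (mul_pos (ha0 _) (ha0 _)).ne', Real.log_mul (ha0 _).ne' (ha0 _).ne']
      at this
    simp only; linarith
  have hv : Subadditive (fun n => Real.log K - Real.log (a n)) := by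
    intro n m
    have := Real.log_le_log (mul_pos (ha0 _) (ha0 _)) (h2 n m)
    rw [Real.log_mul hK0.ne' (ha0 _).ne', Real.log_mul (ha0 _).ne' (ha0 _).ne'] at this
    simp only; linarith
  have hub : BddBelow (range fun n : ℕ => (Real.log K + Real.log (a n)) / n) := by
    refine ⟨0, ?_⟩
    rintro _ ⟨n, rfl⟩
    exact div_nonneg (add_nonneg hlK (hla n)) (Nat.cast_nonneg n)
  have hut := hu.tendsto_lim hub
  have hvt : Tendsto (fun n : ℕ => (Real.log K - Real.log (a n)) / n) atTop (𝓝 (-hu.lim)) := by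
    have h3 : Tendsto (fun n : ℕ => (2 * Real.log K) / (n : ℝ)) atTop (𝓝 0) :=
      tendsto_const_div_atTop_nhds_zero_nat _
    have := h3.sub hut
    rw [zero_sub] at this
    refine this.congr fun n => ?_
    rw [← sub_div]; congr 1; ring
  have hvb : BddBelow (range fun n : ℕ => (Real.log K - Real.log (a n)) / n) :=
    hvt.bddBelow_range
  have hvl : hv.lim = -hu.lim := tendsto_nhds_unique (hv.tendsto_lim hvb) hvt
  refine ⟨hu.lim, fun n => ?_⟩
  rcases eq_or_ne n 0 with rfl | hn
  · have := h1 0 0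
    have := h2 0 0
    simp only [Nat.cast_zero, zero_mul, Real.exp_zero, mul_one, add_zero] at *
    have h0 := ha 0
    constructor
    · nlinarith
    · by_contra hcon
      push Not at hcon
      nlinarith
  have hn' : (0 : ℝ) < n := by exact_mod_cast Nat.pos_of_ne_zero hn
  have l1 := hu.lim_le_div hub hn
  have l2 := hv.lim_le_div hvb hn
  rw [hvl] at l2
  rw [le_div_iff₀ hn'] at l1 l2
  constructor
  · rw [← Real.log_le_log_iff (Real.exp_pos _) (mul_pos hK0 (ha0 _)), Real.log_exp,
      Real.log_mul hK0.ne' (ha0 _).ne']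
    linarith
  · rw [← Real.log_le_log_iff (ha0 _) (mul_pos hK0 (Real.exp_pos _)),
      Real.log_mul hK0.ne' (Real.exp_pos _).ne', Real.log_exp]
    linarith

section G

variable {X : Type*} [MetricSpace X] [CompactSpace X]

lemma scale_change {f : X ≃ₜ X} {α : ℝ} (hα : IsExpansiveWith f α) {δ : ℝ} (hδ : 0 < δ) :
    ∃ C : ℝ, 1 ≤ C ∧ ∀ n, (sN f univ n δ : ℝ) ≤ C * sN f univ n α := by
  classical
  have hα0 := hα.1
  obtain ⟨k, hk⟩ := unif_exp_fwd hα hδ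
  obtain ⟨t, ht⟩ := exists_cover f.continuous k (half_pos hα0)
  choose φ h1 h2 using ht
  refine ⟨(t ×ˢ t).card + 1, by simp; positivity, fun n => ?_⟩
  obtain ⟨E, -, e2, e3, -⟩ := exists_sN f.continuous univ n hδ
  have hcl : ∀ x y, φ x = φ y → BC f k α x y := by
    intro x y hxy j hj
    have a1 := h2 x j hj
    have a2 := h2 y j hj
    rw [← hxy] at a2
    have := dist_triangle_right (f^[j] x) (f^[j] y) (f^[j] (φ x))
    linarith
  have hinv : ∀ x, f^[k] (f.symm^[k] x) = x := fun x =>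
    Function.LeftInverse.iterate (f.apply_symm_apply) k x
  have := card_fiber_le E (t ×ˢ t) (fun x => (φ (f.symm^[k] x), φ (f^[n] x)))
    (fun x _ => Finset.mem_product.2 ⟨h1 _, h1 _⟩) (c := sN f univ n α) (by
    rintro ⟨a, b⟩ _ F hF hb
    have : F.card ≤ sN f univ n α := by
      refine le_sN f.continuous hα0 (subset_univ _) (isSep_iff.2 fun x hx y hy hxy => ?_)
      have hx' := hb x hx
      have hy' := hb y hy
      simp only [Prod.mk.injEq] at hx' hy'
      have c1 := hcl _ _ (hx'.1.trans hy'.1.symm)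
      have c2 := hcl _ _ (hx'.2.trans hy'.2.symm)
      have big : BC f (n + 2 * k) α (f.symm^[k] x) (f.symm^[k] y) := by
        intro j hj
        rcases lt_or_ge j k with hjk | hjk
        · exact c1 j hjk
        obtain ⟨i, rfl⟩ := Nat.exists_eq_add_of_le' hjk
        rw [Function.iterate_add_apply, Function.iterate_add_apply, hinv, hinv]
        rcases lt_or_ge i n with hin | hin
        · exact hxy i hin
        obtain ⟨l, rfl⟩ := Nat.exists_eq_add_of_le' hin
        rw [Function.iterate_add_apply, Function.iterate_add_apply]
        exact c2 l (by omega)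
      refine isSep_iff.1 e2 x (hF hx) y (hF hy) fun j hj => ?_
      have := hk _ _ _ big (j + k) (by omega) (by omega)
      rw [Function.iterate_add_apply, Function.iterate_add_apply, hinv, hinv] at this
      exact this.le
    exact_mod_cast this)
  rw [e3] at this
  refine this.trans ?_
  have : (0 : ℝ) ≤ sN f univ n α := Nat.cast_nonneg _
  nlinarith

lemma super_mult {f : X ≃ₜ X} (hs : HasSpecification f) {α : ℝ} (hα : 0 < α) :
    ∃ m : ℕ, ∀ n₁ n₂, sN f univ n₁ α * sN f univ n₂ α ≤ sN f univ (n₁ + n₂ + m) (α / 2) := by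
  classical
  obtain ⟨m, hm⟩ := spec3 hs (ε := α / 4) (by linarith)
  refine ⟨m, fun n₁ n₂ => ?_⟩
  obtain ⟨A, -, a2, a3, -⟩ := exists_sN f.continuous univ n₁ hα
  obtain ⟨B, -, b2, b3, -⟩ := exists_sN f.continuous univ n₂ hα
  choose z z1 z2 z3 z4 using fun q : X × X => hm n₁ n₂ 0 q.1 q.2 q.1
  have key : ∀ q ∈ A ×ˢ B, ∀ q' ∈ A ×ˢ B, BC f (n₁ + n₂ + m) (α / 2) (z q) (z q') → q = q' := by
    rintro ⟨a, b⟩ hq ⟨a', b'⟩ hq' hbc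
    rw [Finset.mem_product] at hq hq'
    have e1 : a = a' := by
      refine isSep_iff.1 a2 a hq.1 a' hq'.1 fun j hj => ?_
      have i1 := z2 (a, b) j hj
      have i2 := z2 (a', b') j hj
      have i3 := hbc j (by omega)
      have i4 := dist_triangle4_left (f^[j] a) (f^[j] a') (f^[j] (z (a, b))) (f^[j] (z (a', b')))
      have := dist_triangle4 (f^[j] a) (f^[j] (z (a, b))) (f^[j] (z (a', b'))) (f^[j] a')
      rw [dist_comm] at i1
      simp only at i1 i2 i3
      linarith
    have e2 : b = b' := by
      refine isSep_iff.1 b2 b hq.2 b' hq'.2 fun j hj => ?_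
      have i1 := z3 (a, b) j hj
      have i2 := z3 (a', b') j hj
      have i3 := hbc (n₁ + m + j) (by omega)
      have := dist_triangle4 (f^[j] b) (f^[n₁ + m + j] (z (a, b))) (f^[n₁ + m + j] (z (a', b')))
        (f^[j] b')
      rw [dist_comm] at i1
      simp only at i1 i2 i3
      linarith
    rw [e1, e2]
  have hinj : Set.InjOn z ((A ×ˢ B : Finset (X × X)) : Set (X × X)) := by
    intro q hq q' hq' h
    exact key q hq q' hq' (h ▸ BC.refl (by linarith) _)
  have := le_sN f.continuous (n := n₁ + n₂ + m) (half_pos hα) (E := (A ×ˢ B).image z)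
    (subset_univ _) (isSep_iff.2 (by
      intro x hx y hy hxy
      simp only [Finset.coe_image, mem_image, Finset.mem_coe] at hx hy
      obtain ⟨q, hq, rfl⟩ := hx
      obtain ⟨q', hq', rfl⟩ := hy
      rw [key q hq q' hq' hxy]))
  rw [Finset.card_image_of_injOn hinj, Finset.card_product, a3, b3] at this
  exact this

lemma growth [Nonempty X] {f : X ≃ₜ X} {α : ℝ} (hα : IsExpansiveWith f α)
    (hs : HasSpecification f) :
    ∃ h K : ℝ, 1 ≤ K ∧ ∀ n : ℕ, Real.exp (n * h) ≤ K * sN f univ n α ∧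
      sN f univ n α ≤ K * Real.exp (n * h) := by
  have hα0 := hα.1
  obtain ⟨C, hC, hsc⟩ := scale_change hα (half_pos hα0)
  obtain ⟨m, hm⟩ := super_mult hs hα0
  set a : ℕ → ℝ := fun n => sN f univ n α with ha
  have ha1 : ∀ n, 1 ≤ a n := fun n => by
    simp only [ha]; exact_mod_cast sN_pos f.continuous univ_nonempty n hα0
  have sub : ∀ n k, a (n + k) ≤ (C * C) * (a n * a k) := by
    intro n k
    have := sN_submul f.continuous n k (half_pos hα0)
    rw [mul_div_cancel₀ _ two_ne_zero] at this
    have h' : a (n + k) ≤ sN f univ n (α / 2) * sN f univ k (α / 2) := by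
      simp only [ha]; exact_mod_cast this
    refine h'.trans ?_
    have := mul_le_mul (hsc n) (hsc k) (Nat.cast_nonneg _)
      (mul_nonneg (by linarith) (by linarith [ha1 n]))
    refine this.trans (le_of_eq ?_)
    simp only [ha]; ring
  have sup : ∀ n k, a n * a k ≤ (C * (C * C) * a m) * a (n + k) := by
    intro n k
    have h' : a n * a k ≤ sN f univ (n + k + m) (α / 2) := by
      simp only [ha]; exact_mod_cast hm n k
    have h'' := hsc (n + k + m)
    have h3 := mul_le_mul_of_nonneg_left (sub (n + k) m) (by linarith : (0 : ℝ) ≤ C)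
    calc _ ≤ _ := h'
      _ ≤ _ := h''
      _ ≤ _ := h3
      _ = _ := by ring
  have hCC : 1 ≤ C * C := by nlinarith
  have hK1 : C * C ≤ C * (C * C) * a m := by
    have : 1 ≤ C * a m := by nlinarith [ha1 m]
    nlinarith
  obtain ⟨h, hh⟩ := almost_mult ha1 (K := C * (C * C) * a m) (by linarith) (fun n k =>
    (sub n k).trans (mul_le_mul_of_nonneg_right hK1 (by nlinarith [ha1 n, ha1 k]))) sup
  exact ⟨h, _, by linarith, hh⟩

lemma per_finite {f : X ≃ₜ X} {α : ℝ} (hα : IsExpansiveWith f α) {N : ℕ} (hN : 0 < N) :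
    (perSet f N).Finite := by
  by_contra hcon
  obtain ⟨E, h1, h2⟩ := Set.Infinite.exists_subset_card_eq hcon (sN f univ N α + 1)
  have := le_sN f.continuous (n := N) hα.1 (E := E) (subset_univ _) (isSep_iff.2
    fun x hx y hy h => per_sep hα hN (h1 hx) (h1 hy) h)
  omega

lemma per_count {f : X ≃ₜ X} {α : ℝ} (hα : IsExpansiveWith f α) (hs : HasSpecification f) :
    ∃ m : ℕ, ∀ n₁ n₂ n₃ : ℕ, 0 < n₃ → ∀ x₁ x₂, sN f univ n₃ α ≤
      (perSet f (n₁ + m + n₂ + m + n₃ + m) ∩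
        {z | BC f n₁ (α / 6) z x₁ ∧ BC f n₂ (α / 6) (f^[n₁ + m] z) x₂}).ncard := by
  classical
  have hα0 := hα.1
  obtain ⟨m, hm⟩ := spec3 hs (ε := α / 6) (by linarith)
  refine ⟨m, fun n₁ n₂ n₃ h3 x₁ x₂ => ?_⟩
  obtain ⟨A, -, a2, a3, -⟩ := exists_sN f.continuous univ n₃ hα0
  choose z z1 z2 z3 z4 using fun q : X => hm n₁ n₂ n₃ x₁ x₂ q
  have hinj : Set.InjOn z (A : Set X) := by
    intro a ha b hb h
    refine isSep_iff.1 a2 a ha b hb fun j hj => ?_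
    have i1 := z4 a j hj
    have i2 := z4 b j hj
    rw [h] at i1
    have := dist_triangle_left (f^[j] a) (f^[j] b) (f^[n₁ + m + n₂ + m + j] (z b))
    linarith
  rw [← a3, ← Finset.card_image_of_injOn hinj, ← Set.ncard_coe_finset]
  refine Set.ncard_le_ncard ?_ ((per_finite hα (by omega)).subset inter_subset_left)
  intro x hx
  simp only [Finset.coe_image, mem_image, Finset.mem_coe] at hx
  obtain ⟨q, hq, rfl⟩ := hx
  refine ⟨z1 q, z2 q, fun j hj => ?_⟩
  have := z3 q j hj
  rw [← Function.iterate_add_apply, add_comm j]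
  exact this

end G

end Blow

open MeasureTheory Filter Topology Set
open scoped ENNReal NNReal
open Samva

namespace Blow

section G

variable {X : Type*} [MetricSpace X] [CompactSpace X] [MeasurableSpace X] [BorelSpace X]

lemma unif_real {s : Set X} (hs : s.Finite) (t : Set X) :
    (ProbabilityTheory.uniformOn s).real t = (s ∩ t).ncard / s.ncard := by
  unfold ProbabilityTheory.uniformOn
  rw [measureReal_def, ProbabilityTheory.cond_apply hs.measurableSet,
    Measure.count_apply_finite _ hs,
    Measure.count_apply_finite _ (hs.subset inter_subset_left)]
  rw [Set.ncard_eq_toFinset_card _ hs, Set.ncard_eq_toFinset_card _ (hs.subset inter_subset_left)]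
  simp
  rw [mul_comm]; rfl

lemma weak_limit {f : X ≃ₜ X} (P : ℕ → Measure X) (hP : ∀ n, IsProbabilityMeasure (P n))
    (hf : ∀ n, MeasurePreserving f (P n) (P n)) :
    ∃ μ : Measure X, IsProbabilityMeasure μ ∧ MeasurePreserving f μ μ ∧
      (∀ C : Set X, IsClosed C → ∀ r : ℝ, (∀ᶠ n in atTop, r ≤ (P n).real C) → r ≤ μ.real C) ∧
      (∀ U : Set X, IsOpen U → ∀ r : ℝ, (∀ᶠ n in atTop, (P n).real U ≤ r) → μ.real U ≤ r) := by
  let Q : ℕ → ProbabilityMeasure X := fun n => ⟨P n, hP n⟩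
  obtain ⟨μ, hμ⟩ : ∃ μ, Tendsto Q (hyperfilter ℕ : Filter ℕ) (𝓝 μ) := by
    have := ((hyperfilter ℕ).map Q).le_nhds_lim
    exact ⟨_, this⟩
  have hle : (hyperfilter ℕ : Filter ℕ) ≤ atTop := by
    rw [← Nat.cofinite_eq_atTop]; exact hyperfilter_le_cofinite
  refine ⟨μ, μ.2, ⟨f.continuous.measurable, ?_⟩, ?_, ?_⟩
  · have h1 := ProbabilityMeasure.tendsto_map_of_tendsto_of_continuous Q μ hμ f.continuous
    have h2 : (fun i => (Q i).map f.continuous.measurable.aemeasurable) = Q := by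
      funext i
      exact Subtype.ext (hf i).map_eq
    rw [h2] at h1
    have := tendsto_nhds_unique h1 hμ
    exact congrArg Subtype.val this
  · intro C hC r hr
    have h1 := ProbabilityMeasure.limsup_measure_closed_le_of_tendsto hμ hC
    have h2 : ENNReal.ofReal r ≤ limsup (fun i => (Q i : Measure X) C) (hyperfilter ℕ : Filter ℕ) := by
      refine le_limsup_of_frequently_le (Eventually.frequently ?_)
      filter_upwards [hle hr] with n hn
      exact ENNReal.ofReal_le_of_le_toReal hn
    have h3 := h2.trans h1
    exact (ENNReal.ofReal_le_iff_le_toReal (measure_ne_top _ _)).1 h3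
  · intro C hC r hr
    have h1 := ProbabilityMeasure.le_liminf_measure_open_of_tendsto hμ hC
    have h2 : liminf (fun i => (Q i : Measure X) C) (hyperfilter ℕ : Filter ℕ) ≤ ENNReal.ofReal r := by
      refine liminf_le_of_frequently_le (Eventually.frequently ?_)
      filter_upwards [hle hr] with n hn
      have := hP n
      rw [ENNReal.le_ofReal_iff_toReal_le (measure_ne_top _ _) (measureReal_nonneg.trans hn)]
      exact hn
    have h3 := h1.trans h2
    obtain ⟨n, hn⟩ := hr.exists
    exact (ENNReal.le_ofReal_iff_toReal_le (measure_ne_top _ _) (measureReal_nonneg.trans hn)).1 h3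

lemma per_preserving {f : X ≃ₜ X} {N : ℕ} (hfin : (perSet f N).Finite)
    (hne : (perSet f N).Nonempty) :
    MeasurePreserving f (ProbabilityTheory.uniformOn (perSet f N))
      (ProbabilityTheory.uniformOn (perSet f N)) := by
  have := ProbabilityTheory.isProbabilityMeasure_uniformOn hfin hne
  refine ⟨f.continuous.measurable, Measure.ext fun A hA => ?_⟩
  rw [Measure.map_apply f.continuous.measurable hA]
  rw [← ENNReal.toReal_eq_toReal_iff' (measure_ne_top _ _) (measure_ne_top _ _)]
  change (ProbabilityTheory.uniformOn (perSet f N)).real _ =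
    (ProbabilityTheory.uniformOn (perSet f N)).real _
  rw [unif_real hfin, unif_real hfin]
  congr 2
  rw [← Set.ncard_image_of_injective _ f.injective]
  congr 1
  ext y
  constructor
  · rintro ⟨x, ⟨h1, h2⟩, rfl⟩
    refine ⟨?_, h2⟩
    change f^[N] (f x) = f x
    rw [← Function.iterate_succ_apply, Function.iterate_succ_apply', h1]
  · rintro ⟨h1, h2⟩
    refine ⟨f.symm y, ⟨?_, by simpa using h2⟩, by simp⟩
    change f^[N] (f.symm y) = f.symm y
    apply f.injective
    rw [← Function.iterate_succ_apply' f, Function.iterate_succ_apply f]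
    simp only [f.apply_symm_apply]; exact h1

lemma isClosed_BC {T : X → X} (hT : Continuous T) (n : ℕ) (ε : ℝ) (x : X) :
    IsClosed {z | BC T n ε z x} := by
  simp only [BC, Set.ofPred_forall]
  exact isClosed_iInter fun j => isClosed_iInter fun _ =>
    isClosed_le ((hT.iterate j).dist continuous_const) continuous_const

lemma isOpen_Bowen {T : X → X} (hT : Continuous T) (n : ℕ) (ε : ℝ) (x : X) :
    IsOpen {z | ∀ j < n, dist (T^[j] z) (T^[j] x) < ε} := by
  have : {z | ∀ j < n, dist (T^[j] z) (T^[j] x) < ε} =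
      ⋂ j ∈ Finset.range n, {z | dist (T^[j] z) (T^[j] x) < ε} := by
    ext; simp
  rw [this]
  exact isOpen_biInter_finset fun j _ =>
    isOpen_lt ((hT.iterate j).dist continuous_const) continuous_const

/-- The Bowen measure together with its Gibbs bounds. -/
lemma bowen [Nonempty X] {f : X ≃ₜ X} {α : ℝ} (hα : IsExpansiveWith f α)
    (hs : HasSpecification f) {h K : ℝ} (hK : 1 ≤ K)
    (hg : ∀ n : ℕ, Real.exp (n * h) ≤ K * sN f univ n α ∧
      sN f univ n α ≤ K * Real.exp (n * h)) :
    ∃ (μ : Measure X) (C c : ℝ) (m : ℕ), IsProbabilityMeasure μ ∧ MeasurePreserving f μ μ ∧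
      0 < C ∧ 0 < c ∧
      (∀ (n : ℕ) (x : X), μ.real {z | ∀ j < n, dist (f^[j] z) (f^[j] x) < α / 2} ≤ C * Real.exp (-(n * h))) ∧
      (∀ (n₁ n₂ : ℕ) (x y : X), c * Real.exp (-((n₁ + n₂) * h)) ≤
        μ.real {z | BC f n₁ (α / 6) z x ∧ BC f n₂ (α / 6) (f^[n₁ + m] z) y}) := by
  classical
  have hα0 := hα.1
  have hK0 : 0 < K := by linarith
  obtain ⟨m, hm⟩ := per_count hα hs
  have hfin : ∀ N, 0 < N → (perSet f N).Finite := fun N hN => per_finite hα hN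
  obtain ⟨x₀⟩ := ‹Nonempty X›
  have hsep : ∀ N, 0 < N → (perSet f N).ncard ≤ sN f univ N α := by
    intro N hN
    rw [Set.ncard_eq_toFinset_card _ (hfin N hN)]
    exact le_sN f.continuous hα0 (subset_univ _) (isSep_iff.2 fun x hx y hy h =>
      per_sep hα hN ((Set.Finite.mem_toFinset (hfin N hN)).1 hx) ((Set.Finite.mem_toFinset (hfin N hN)).1 hy) h)
  have hlow : ∀ n : ℕ, 0 < n → Real.exp (n * h) / K ≤ (perSet f (n + 3 * m)).ncard := by
    intro n hn
    have h1 := hm 0 0 n hn x₀ x₀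
    have h2 : (perSet f (0 + m + 0 + m + n + m) ∩
        {z | BC f 0 (α / 6) z x₀ ∧ BC f 0 (α / 6) (f^[0 + m] z) x₀}).ncard ≤
        (perSet f (0 + m + 0 + m + n + m)).ncard :=
      Set.ncard_le_ncard inter_subset_left (hfin _ (by omega))
    rw [show 0 + m + 0 + m + n + m = n + 3 * m by ring] at h1 h2
    have h3 : (sN f univ n α : ℝ) ≤ (perSet f (n + 3 * m)).ncard := by exact_mod_cast h1.trans h2
    rw [div_le_iff₀ hK0, mul_comm _ K]
    exact (hg n).1.trans (by gcongr)
  let P : ℕ → Measure X := fun i => ProbabilityTheory.uniformOn (perSet f (i + 1 + 3 * m))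
  have hpos : ∀ i : ℕ, 0 < (perSet f (i + 1 + 3 * m)).ncard := by
    intro i
    have := hlow (i + 1) (by omega)
    have h' : (0 : ℝ) < (perSet f (i + 1 + 3 * m)).ncard :=
      lt_of_lt_of_le (div_pos (Real.exp_pos _) hK0) this
    exact_mod_cast h'
  have hne : ∀ i : ℕ, (perSet f (i + 1 + 3 * m)).Nonempty := fun i =>
    Set.nonempty_of_ncard_ne_zero (hpos i).ne'
  have hfin' : ∀ i : ℕ, (perSet f (i + 1 + 3 * m)).Finite := fun i => hfin _ (by omega)
  obtain ⟨μ, μ1, μ2, μ3, μ4⟩ := weak_limit (f := f) P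
    (fun i => ProbabilityTheory.isProbabilityMeasure_uniformOn (hfin' i) (hne i))
    (fun i => per_preserving (hfin' i) (hne i))
  refine ⟨μ, K * K * Real.exp (3 * m * h), 1 / (K * K) * Real.exp (-(3 * m * h)), m, μ1, μ2,
    by positivity, by positivity, ?_, ?_⟩
  · intro n x
    refine μ4 _ (isOpen_Bowen f.continuous n _ x) _ ?_
    filter_upwards [eventually_ge_atTop n] with i hi
    simp only [P]
    rw [unif_real (hfin' i)]
    set N := i + 1 + 3 * m with hN
    have hcard : (perSet f N ∩ {z | ∀ j < n, dist (f^[j] z) (f^[j] x) < α / 2}).ncard ≤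
        sN f univ (N - n) α := by
      have hF := (hfin' i).subset
        (inter_subset_left (s := perSet f N) (t := {z | ∀ j < n, dist (f^[j] z) (f^[j] x) < α / 2}))
      rw [← Set.ncard_image_of_injective _ (f.injective.iterate n),
        Set.ncard_eq_toFinset_card _ (hF.image _)]
      refine le_sN f.continuous hα0 (subset_univ _) (isSep_iff.2 ?_)
      intro y hy z hz hyz
      simp only [Set.Finite.coe_toFinset, mem_image] at hy hz
      obtain ⟨y, hy, rfl⟩ := hy
      obtain ⟨z, hz, rfl⟩ := hz
      congr 1
      refine per_sep hα (by omega : 0 < N) hy.1 hz.1 fun j hj => ?_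
      rcases lt_or_ge j n with hjn | hjn
      · have i1 := hy.2 j hjn
        have i2 := hz.2 j hjn
        have := dist_triangle_right (f^[j] y) (f^[j] z) (f^[j] x)
        linarith
      · obtain ⟨l, rfl⟩ := Nat.exists_eq_add_of_le' hjn
        rw [Function.iterate_add_apply, Function.iterate_add_apply]
        exact hyz l (by omega)
    have h1 : ((perSet f N ∩ {z | ∀ j < n, dist (f^[j] z) (f^[j] x) < α / 2}).ncard : ℝ) ≤
        K * Real.exp ((N - n) * h) := by
      have := (hg (N - n)).2
      rw [Nat.cast_sub (by omega)] at this
      exact le_trans (by exact_mod_cast hcard) this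
    have h2 := hlow (i + 1) (by omega)
    rw [← hN] at h2
    have h3 : (0 : ℝ) < (perSet f N).ncard := by exact_mod_cast hpos i
    rw [div_le_iff₀ h3]
    refine h1.trans ?_
    calc K * Real.exp ((N - n) * h) =
        K * K * Real.exp (3 * m * h) * Real.exp (-(n * h)) * (Real.exp ((i + 1 : ℕ) * h) / K) := by
          have : ((N : ℝ) - n) * h = 3 * m * h + -(n * h) + (i + 1 : ℕ) * h := by
            rw [hN]; push_cast; ring
          rw [this, Real.exp_add, Real.exp_add]
          field_simp
      _ ≤ _ := by gcongr
  · intro n₁ n₂ x y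
    refine μ3 _ ?_ _ ?_
    · exact (isClosed_BC f.continuous _ _ _).inter
        ((isClosed_BC f.continuous _ _ _).preimage (f.continuous.iterate _))
    filter_upwards [eventually_ge_atTop (n₁ + n₂)] with i hi
    simp only [P]
    rw [unif_real (hfin' i)]
    have h1 := hm n₁ n₂ (i + 1 - n₁ - n₂) (by omega) x y
    rw [show n₁ + m + n₂ + m + (i + 1 - n₁ - n₂) + m = i + 1 + 3 * m by omega] at h1
    set N := i + 1 + 3 * m with hN
    have h3 : (0 : ℝ) < (perSet f N).ncard := by exact_mod_cast hpos i
    rw [le_div_iff₀ h3]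
    have h4 : ((perSet f N).ncard : ℝ) ≤ K * Real.exp (N * h) :=
      le_trans (by exact_mod_cast hsep N (by omega)) (hg N).2
    have h5 := (hg (i + 1 - n₁ - n₂)).1
    have h6 : (sN f univ (i + 1 - n₁ - n₂) α : ℝ) ≤ (perSet f N ∩
        {z | BC f n₁ (α / 6) z x ∧ BC f n₂ (α / 6) (f^[n₁ + m] z) y}).ncard := by
      exact_mod_cast h1
    have h7 : Real.exp ((i + 1 - n₁ - n₂ : ℕ) * h) / K ≤ (perSet f N ∩
        {z | BC f n₁ (α / 6) z x ∧ BC f n₂ (α / 6) (f^[n₁ + m] z) y}).ncard := by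
      rw [div_le_iff₀ hK0, mul_comm _ K]
      exact h5.trans (by gcongr)
    refine le_trans ?_ h7
    calc _ ≤ 1 / (K * K) * Real.exp (-(3 * m * h)) * Real.exp (-((n₁ + n₂) * h)) *
          (K * Real.exp (N * h)) := by gcongr
      _ = _ := by
          have : ((i + 1 - n₁ - n₂ : ℕ) : ℝ) * h =
              -(3 * m * h) + -((n₁ + n₂) * h) + N * h := by
            rw [Nat.cast_sub (by omega), Nat.cast_sub (by omega), hN]; push_cast; ring
          rw [this, Real.exp_add, Real.exp_add]
          field_simp

end G

end Blow

open MeasureTheory Filter Topology Set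
open scoped ENNReal NNReal
open Samva

namespace Blow

lemma exists_sel {Ω : Type*} [MeasurableSpace Ω] {ι : Type*} [Fintype ι] (S : ι → Set Ω)
    (hS : ∀ i, MeasurableSet (S i)) (hc : ∀ x, ∃ i, x ∈ S i) :
    ∃ D : Ω → ι, MF D ∧ ∀ x, x ∈ S (D x) := by
  classical
  have key : ∀ (N : ℕ) (S : Fin N → Set Ω), (∀ i, MeasurableSet (S i)) → (∀ x, ∃ i, x ∈ S i) →
      ∃ D : Ω → Fin N, MF D ∧ ∀ x, x ∈ S (D x) := by
    intro N S hS hc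
    have hne : ∀ x, (Finset.univ.filter fun i => x ∈ S i).Nonempty := fun x =>
      let ⟨i, hi⟩ := hc x
      ⟨i, by simpa using hi⟩
    refine ⟨fun x => (Finset.univ.filter fun i => x ∈ S i).min' (hne x), fun i => ?_, fun x => ?_⟩
    · have : (fun x => (Finset.univ.filter fun i => x ∈ S i).min' (hne x)) ⁻¹' {i} =
          S i ∩ ⋂ j ∈ Finset.univ.filter (fun j => j < i), (S j)ᶜ := by
        ext x
        simp only [mem_preimage, mem_singleton_iff, mem_inter_iff, mem_iInter, Finset.mem_filter,
          Finset.mem_univ, true_and, mem_compl_iff]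
        constructor
        · rintro rfl
          refine ⟨by simpa using Finset.min'_mem _ (hne x), fun j hj hx => ?_⟩
          exact absurd (Finset.min'_le _ j (by simpa using hx)) (not_le.2 hj)
        · rintro ⟨h1, h2⟩
          apply le_antisymm
          · exact Finset.min'_le _ _ (by simpa using h1)
          · by_contra hcon
            push Not at hcon
            exact h2 _ hcon (by simpa using Finset.min'_mem _ (hne x))
      rw [this]
      exact (hS i).inter (Finset.measurableSet_biInter _ fun j _ => (hS j).compl)
    · simpa using Finset.min'_mem _ (hne x)
  let e := Fintype.equivFin ι
  obtain ⟨D, h1, h2⟩ := key _ (fun i => S (e.symm i)) (fun i => hS _) (fun x => by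
    obtain ⟨i, hi⟩ := hc x
    exact ⟨e i, by simpa using hi⟩)
  exact ⟨e.symm ∘ D, h1.comp _, h2⟩

lemma card_mul_le {Ω κ : Type*} [MeasurableSpace Ω] {μ : Measure Ω} [IsFiniteMeasure μ]
    (T : Finset κ) (S : κ → Set Ω) (hS : ∀ i, MeasurableSet (S i))
    (hd : ∀ i ∈ T, ∀ j ∈ T, ∀ x, x ∈ S i → x ∈ S j → i = j) {r : ℝ}
    (hr : ∀ i, r ≤ μ.real (S i)) {W : Set Ω} (hW : ∀ i ∈ T, S i ⊆ W) :
    T.card * r ≤ μ.real W := by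
  have h1 : μ.real (⋃ i ∈ T, S i) = ∑ i ∈ T, μ.real (S i) := by
    refine measureReal_biUnion_finset ?_ fun i _ => hS i
    intro i hi j hj hij
    refine Set.disjoint_left.2 fun x hx hy => hij (hd i hi j hj x hx hy)
  calc T.card * r = ∑ i ∈ T, r := by simp
    _ ≤ ∑ i ∈ T, μ.real (S i) := Finset.sum_le_sum fun i _ => hr i
    _ = μ.real (⋃ i ∈ T, S i) := h1.symm
    _ ≤ _ := measureReal_mono (iUnion₂_subset hW)

section G

variable {X : Type*} [MetricSpace X] [CompactSpace X] [MeasurableSpace X] [BorelSpace X]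

/-- The properties of the Bowen measure we use. -/
structure GM (f : X ≃ₜ X) (α h : ℝ) (μ : Measure X) (C c : ℝ) (m : ℕ) : Prop where
  prob : IsProbabilityMeasure μ
  mp : MeasurePreserving f μ μ
  hC : 0 < C
  hc : 0 < c
  upper : ∀ (n : ℕ) (x : X),
    μ.real {z | ∀ j < n, dist (f^[j] z) (f^[j] x) < α / 2} ≤ C * Real.exp (-(n * h))
  lower : ∀ (n₁ n₂ : ℕ) (x y : X), c * Real.exp (-((n₁ + n₂) * h)) ≤
        μ.real {z | BC f n₁ (α / 6) z x ∧ BC f n₂ (α / 6) (f^[n₁ + m] z) y}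

variable {f : X ≃ₜ X} {α h : ℝ} {μ : Measure X} {C c : ℝ} {m : ℕ}

lemma GM.lower1 (H : GM f α h μ C c m) (n : ℕ) (x : X) :
    c * Real.exp (-(n * h)) ≤ μ.real {z | BC f n (α / 6) z x} := by
  have := H.prob
  have h1 := H.lower n 0 x x
  simp only [Nat.cast_zero, add_zero] at h1
  exact h1.trans (measureReal_mono fun z hz => hz.1)

lemma exists_nhd {K U : Set X} (hK : IsCompact K) (hU : IsOpen U) (hKU : K ⊆ U) :
    ∃ δ > 0, ∀ x ∈ K, ∀ y, dist y x < δ → y ∈ U := by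
  obtain ⟨δ, h1, h2⟩ := hK.exists_thickening_subset_open hU hKU
  exact ⟨δ, h1, fun x hx y hy => h2 (Metric.mem_thickening_iff.2 ⟨x, hx, hy⟩)⟩

lemma GM.mix (H : GM f α h μ C c m) (hα : IsExpansiveWith f α) {K L U V : Set X}
    (hK : IsCompact K) (hL : IsCompact L) (hU : IsOpen U) (hV : IsOpen V) (hKU : K ⊆ U)
    (hLV : L ⊆ V) :
    ∃ a b : ℕ, c / C ^ 2 * μ.real K * μ.real L ≤ μ.real (f^[a] ⁻¹' U ∩ f^[b] ⁻¹' V) := by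
  classical
  have := H.prob
  have hα0 := hα.1
  have hC := H.hC
  have hc := H.hc
  obtain ⟨δ₁, d1, d1'⟩ := exists_nhd hK hU hKU
  obtain ⟨δ₂, d2, d2'⟩ := exists_nhd hL hV hLV
  obtain ⟨k, hk⟩ := unif_exp_fwd hα (lt_min d1 d2)
  set n := 2 * k + 1 with hn
  obtain ⟨E, -, e2, -, e4⟩ := exists_sN f.continuous univ n (ε := α / 3) (by linarith)
  rw [isSep_iff] at e2
  have cnt : ∀ K : Set X, IsCompact K → μ.real K ≤
      (E.filter fun e => ∃ x, BC f n (α / 3) x e ∧ f^[k] x ∈ K).card *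
        (C * Real.exp (-(n * h))) := by
    intro K hK
    have h1 : μ.real K = μ.real (f^[k] ⁻¹' K) := by
      rw [measureReal_def, measureReal_def,
        (H.mp.iterate k).measure_preimage hK.measurableSet.nullMeasurableSet]
    rw [h1]
    calc _ ≤ μ.real (⋃ e ∈ (E.filter fun e => ∃ x, BC f n (α / 3) x e ∧ f^[k] x ∈ K),
          {z | ∀ j < n, dist (f^[j] z) (f^[j] e) < α / 2}) := by
          refine measureReal_mono (fun x hx => ?_) (measure_ne_top _ _)
          obtain ⟨e, he, hxe⟩ := e4 x (mem_univ _)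
          simp only [mem_iUnion]
          refine ⟨e, Finset.mem_filter.2 ⟨he, x, hxe, hx⟩, fun j hj => ?_⟩
          have := hxe j hj
          linarith
      _ ≤ ∑ e ∈ (E.filter fun e => ∃ x, BC f n (α / 3) x e ∧ f^[k] x ∈ K),
          μ.real {z | ∀ j < n, dist (f^[j] z) (f^[j] e) < α / 2} :=
          measureReal_biUnion_finset_le _ _
      _ ≤ _ := by
          rw [← nsmul_eq_mul]
          exact Finset.sum_le_card_nsmul _ _ _ fun e _ => H.upper n e
  have cK := cnt K hK
  have cL := cnt L hL
  set A := E.filter fun e => ∃ x, BC f n (α / 3) x e ∧ f^[k] x ∈ K with hA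
  set B := E.filter fun e => ∃ x, BC f n (α / 3) x e ∧ f^[k] x ∈ L with hB
  refine ⟨k, k + (n + m), ?_⟩
  have main := card_mul_le (μ := μ) (A ×ˢ B)
    (fun q => {z | BC f n (α / 6) z q.1 ∧ BC f n (α / 6) (f^[n + m] z) q.2})
    (fun q => ((isClosed_BC f.continuous _ _ _).inter
        ((isClosed_BC f.continuous _ _ _).preimage (f.continuous.iterate _))).measurableSet)
    (by
      rintro ⟨a, b⟩ hq ⟨a', b'⟩ hq' z hz hz'
      rw [Finset.mem_product] at hq hq'
      have ha := e2 a (Finset.mem_filter.1 hq.1).1 a' (Finset.mem_filter.1 hq'.1).1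
        ((hz.1.symm.trans hz'.1).mono (by linarith))
      have hb := e2 b (Finset.mem_filter.1 hq.2).1 b' (Finset.mem_filter.1 hq'.2).1
        ((hz.2.symm.trans hz'.2).mono (by linarith))
      rw [ha, hb])
    (fun q => H.lower n n q.1 q.2) (W := f^[k] ⁻¹' U ∩ f^[k + (n + m)] ⁻¹' V) (by
      rintro ⟨a, b⟩ hq z hz
      rw [Finset.mem_product] at hq
      obtain ⟨x, x1, x2⟩ := (Finset.mem_filter.1 hq.1).2
      obtain ⟨y, y1, y2⟩ := (Finset.mem_filter.1 hq.2).2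
      refine ⟨d1' _ x2 _ ?_, d2' _ y2 _ ?_⟩
      · exact lt_of_lt_of_le (hk n _ _ ((hz.1.trans x1.symm).mono (by linarith)) k le_rfl
          (by omega)) (min_le_left _ _)
      · rw [Function.iterate_add_apply]
        exact lt_of_lt_of_le (hk n _ _ ((hz.2.trans y1.symm).mono (by linarith)) k le_rfl
          (by omega)) (min_le_right _ _))
  refine le_trans ?_ main
  rw [Finset.card_product]
  push_cast
  have hexp : Real.exp (-((n + n) * h)) = Real.exp (-(n * h)) * Real.exp (-(n * h)) := by
    rw [← Real.exp_add]; congr 1; ring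
  rw [hexp]
  set t := Real.exp (-(n * h))
  have : μ.real K * μ.real L ≤ (A.card * (C * t)) * (B.card * (C * t)) :=
    mul_le_mul cK cL measureReal_nonneg (measureReal_nonneg.trans cK)
  calc _ = c / C ^ 2 * (μ.real K * μ.real L) := by ring
    _ ≤ c / C ^ 2 * ((A.card * (C * t)) * (B.card * (C * t))) := by gcongr
    _ = _ := by field_simp

lemma GM.ergodic (H : GM f α h μ C c m) (hα : IsExpansiveWith f α) : Ergodic f μ := by
  have := H.prob
  refine ⟨H.mp, ⟨fun {A} hA hinv => ?_⟩⟩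
  have hit : ∀ k : ℕ, f^[k] ⁻¹' A = A := by
    intro k
    induction k with
    | zero => rfl
    | succ k ih => rw [Function.iterate_succ, preimage_comp, ih, hinv]
  by_contra hcon
  have hA1 : μ A ≠ 0 := by
    intro h0
    exact hcon (eventuallyConst_set'.2 (Or.inl (ae_eq_empty.2 h0)))
  have hA2 : μ Aᶜ ≠ 0 := by
    intro h0
    exact hcon (eventuallyConst_set'.2 (Or.inr (ae_eq_univ.2 h0)))
  obtain ⟨K, k1, k2, k3⟩ := hA.exists_lt_isCompact_of_ne_top (measure_ne_top _ _)
    (pos_iff_ne_zero.2 hA1)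
  obtain ⟨L, l1, l2, l3⟩ := hA.compl.exists_lt_isCompact_of_ne_top (measure_ne_top _ _)
    (pos_iff_ne_zero.2 hA2)
  have k4 : 0 < μ.real K := ENNReal.toReal_pos k3.ne' (measure_ne_top _ _)
  have l4 : 0 < μ.real L := ENNReal.toReal_pos l3.ne' (measure_ne_top _ _)
  have hη : 0 < c / C ^ 2 * μ.real K * μ.real L := by
    have := H.hC; have := H.hc; positivity
  set η := c / C ^ 2 * μ.real K * μ.real L with hηdef
  have outer : ∀ A : Set X, MeasurableSet A → ∃ U, A ⊆ U ∧ IsOpen U ∧ μ.real (U \ A) < η / 4 := by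
    intro A hA
    obtain ⟨U, u1, u2, u3, u4⟩ := hA.exists_isOpen_sdiff_lt (μ := μ) (measure_ne_top _ _)
      (ε := ENNReal.ofReal (η / 4)) (by simpa using hη)
    refine ⟨U, u1, u2, ?_⟩
    rw [measureReal_def]
    exact (ENNReal.lt_ofReal_iff_toReal_lt (measure_ne_top _ _)).1 u4
  obtain ⟨U, u1, u2, u3⟩ := outer A hA
  obtain ⟨V, v1, v2, v3⟩ := outer Aᶜ hA.compl
  obtain ⟨a, b, hab⟩ := H.mix hα k2 l2 u2 v2 (k1.trans u1) (l1.trans v1)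
  have hpre : ∀ (k : ℕ) (S : Set X), MeasurableSet S → μ.real (f^[k] ⁻¹' S) = μ.real S := by
    intro k S hS
    rw [measureReal_def, measureReal_def, (H.mp.iterate k).measure_preimage hS.nullMeasurableSet]
  have hsub : f^[a] ⁻¹' U ∩ f^[b] ⁻¹' V ⊆ f^[a] ⁻¹' (U \ A) ∪ f^[b] ⁻¹' (V \ Aᶜ) := by
    rintro z ⟨h1, h2⟩
    by_cases hz : z ∈ A
    · right
      refine ⟨h2, fun h3 => h3 ?_⟩
      rw [← hit b] at hz; exact hz
    · left
      refine ⟨h1, fun h3 => hz ?_⟩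
      rw [← hit a]; exact h3
  have h1 := measureReal_mono (μ := μ) hsub
  have h2 := measureReal_union_le (μ := μ) (f^[a] ⁻¹' (U \ A)) (f^[b] ⁻¹' (V \ Aᶜ))
  rw [hpre _ _ (u2.measurableSet.diff hA), hpre _ _ (v2.measurableSet.diff hA.compl)] at h2
  linarith

lemma GM.ac (H : GM f α h μ C c m) (hα : IsExpansiveWith f α) {μ' : Measure X}
    [IsProbabilityMeasure μ'] (hμ' : MeasurePreserving f μ' μ')
    (hH : ∀ (n : ℕ) (E : Finset X) (D : X → E), 0 < n → MF D → (∀ x, BC f n (α / 3) x (D x)) →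
      n * h ≤ HH μ' D) : μ' ≪ μ := by
  classical
  have := H.prob
  have hα0 := hα.1
  have hc := H.hc
  refine Measure.AbsolutelyContinuous.mk fun A hA hA0 => ?_
  by_contra hcon
  obtain ⟨K, k1, k2, k3⟩ := hA.exists_lt_isCompact_of_ne_top (measure_ne_top _ _)
    (pos_iff_ne_zero.2 hcon)
  have k4 : 0 < μ'.real K := ENNReal.toReal_pos k3.ne' (measure_ne_top _ _)
  have hμK : μ K = 0 := measure_mono_null k1 hA0
  set q₀ := μ'.real K with hq₀
  have hne : Nonempty X := by
    by_contra hn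
    rw [not_nonempty_iff] at hn
    have : K = ∅ := Set.eq_empty_of_isEmpty K
    simp [this] at k3
  have hc1 : c ≤ 1 := by
    have := H.lower1 0 hne.some
    simp only [Nat.cast_zero, zero_mul, neg_zero, Real.exp_zero, mul_one] at this
    exact this.trans measureReal_le_one
  have hlc : Real.log c ≤ 0 := Real.log_nonpos hc.le hc1
  set t := Real.exp (-(3 - Real.log c) / q₀) with ht
  have ht0 : 0 < t := Real.exp_pos _
  have hlt : Real.log t = -(3 - Real.log c) / q₀ := Real.log_exp _
  have hlt0 : Real.log t ≤ 0 := by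
    rw [hlt]; exact div_nonpos_of_nonpos_of_nonneg (by linarith) k4.le
  obtain ⟨U, u1, u2, u3⟩ := K.exists_isOpen_lt_of_lt (μ := μ) (ENNReal.ofReal t)
    (by rw [hμK]; simpa using ht0)
  have u4 : μ.real U ≤ t := ((ENNReal.lt_ofReal_iff_toReal_lt (measure_ne_top _ _)).1 u3).le
  obtain ⟨δ, d1, d1'⟩ := exists_nhd k2 u2 u1
  obtain ⟨k, hk⟩ := unif_exp_fwd hα d1
  set n := 2 * k + 1 with hn
  obtain ⟨E, -, e2, -, e4⟩ := exists_sN f.continuous univ n (ε := α / 3) (by linarith)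
  rw [isSep_iff] at e2
  obtain ⟨D, D1, D2⟩ := exists_sel (ι := E) (fun e => {x | BC f n (α / 3) x e})
    (fun e => (isClosed_BC f.continuous _ _ _).measurableSet) (fun x => by
      obtain ⟨e, he, hx⟩ := e4 x (mem_univ _)
      exact ⟨⟨e, he⟩, hx⟩)
  have hD := hH n E D (by omega) D1 D2
  have cnt : ∀ (T : Finset E) (W : Set X), (∀ e ∈ T, {z | BC f n (α / 6) z (e : X)} ⊆ W) →
      (T.card : ℝ) ≤ μ.real W * Real.exp (n * h) / c := by
    intro T W hW
    have := card_mul_le (μ := μ) T (fun e : E => {z | BC f n (α / 6) z (e : X)})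
      (fun e => (isClosed_BC f.continuous _ _ _).measurableSet) (by
        intro e he e' he' z hz hz'
        exact Subtype.ext (e2 e e.2 e' e'.2 ((BC.trans (BC.symm hz) hz').mono (by linarith))))
      (fun e => H.lower1 n e) hW
    rw [le_div_iff₀ hc]
    calc (T.card : ℝ) * c = (T.card * (c * Real.exp (-(n * h)))) * Real.exp (n * h) := by
          rw [mul_assoc, mul_assoc, ← Real.exp_add]; simp
      _ ≤ _ := by gcongr
  set T : Finset E := Finset.univ.filter fun e => ∃ x, D x = e ∧ f^[k] x ∈ K with hT
  have cT : (T.card : ℝ) ≤ t * Real.exp (n * h) / c := by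
    have hUk : μ.real (f^[k] ⁻¹' U) ≤ t := by
      rwa [measureReal_def, (H.mp.iterate k).measure_preimage u2.measurableSet.nullMeasurableSet]
    refine (cnt T (f^[k] ⁻¹' U) ?_).trans (by gcongr)
    intro e he z hz
    obtain ⟨x, hx, hxK⟩ := (Finset.mem_filter.1 he).2
    have hxe := D2 x
    rw [hx] at hxe
    exact d1' _ hxK _ (hk n _ _ ((BC.trans hz (BC.symm hxe)).mono (by linarith)) k le_rfl (by omega))
  have cTc : (Tᶜ.card : ℝ) ≤ Real.exp (n * h) / c := by
    refine (cnt Tᶜ univ fun _ _ => subset_univ _).trans ?_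
    simp
  have s1 := sum_negMulLog_le T (fun e => μ'.real (D ⁻¹' {e})) (fun _ _ => measureReal_nonneg)
    (by positivity) cT
  have s2 := sum_negMulLog_le Tᶜ (fun e => μ'.real (D ⁻¹' {e})) (fun _ _ => measureReal_nonneg)
    (by positivity) cTc
  have hsum : HH μ' D = ∑ e ∈ T, Real.negMulLog (μ'.real (D ⁻¹' {e})) +
      ∑ e ∈ Tᶜ, Real.negMulLog (μ'.real (D ⁻¹' {e})) := (Finset.sum_add_sum_compl T _).symm
  have hone : ∑ e ∈ T, μ'.real (D ⁻¹' {e}) + ∑ e ∈ Tᶜ, μ'.real (D ⁻¹' {e}) = 1 := by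
    rw [Finset.sum_add_sum_compl, sum_real_preimage D1]
  have hq : q₀ ≤ ∑ e ∈ T, μ'.real (D ⁻¹' {e}) := by
    rw [← real_preimage_eq D1]
    have : q₀ = μ'.real (f^[k] ⁻¹' K) := by
      rw [hq₀, measureReal_def, measureReal_def,
        (hμ'.iterate k).measure_preimage k2.measurableSet.nullMeasurableSet]
    rw [this]
    refine measureReal_mono fun x hx => ?_
    exact Finset.mem_coe.2 (Finset.mem_filter.2 ⟨Finset.mem_univ _, x, rfl, hx⟩)
  have hr : 0 ≤ ∑ e ∈ Tᶜ, μ'.real (D ⁻¹' {e}) := Finset.sum_nonneg fun _ _ => measureReal_nonneg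
  set q := ∑ e ∈ T, μ'.real (D ⁻¹' {e}) with hqd
  set r := ∑ e ∈ Tᶜ, μ'.real (D ⁻¹' {e}) with hrd
  have n1 := Real.negMulLog_le_one_sub_self (k4.le.trans hq)
  have n2 := Real.negMulLog_le_one_sub_self hr
  rw [Real.log_div (by positivity) hc.ne', Real.log_mul ht0.ne' (Real.exp_pos _).ne',
    Real.log_exp (n * h)] at s1
  rw [Real.log_div (by positivity) hc.ne', Real.log_exp] at s2
  have hqt : q * Real.log t ≤ -(3 - Real.log c) := by
    calc q * Real.log t ≤ q₀ * Real.log t := mul_le_mul_of_nonpos_right hq hlt0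
      _ = _ := by rw [hlt]; field_simp
  have hrq : r = 1 - q := by linarith
  rw [hrq] at s2 n2
  rw [hsum] at hD
  linarith [mul_add q (Real.log t) (n * h - Real.log c)]

lemma GM.eq_of (H : GM f α h μ C c m) (hα : IsExpansiveWith f α) {μ' : Measure X}
    [IsProbabilityMeasure μ'] (hμ' : MeasurePreserving f μ' μ')
    (hH : ∀ (n : ℕ) (E : Finset X) (D : X → E), 0 < n → MF D → (∀ x, BC f n (α / 3) x (D x)) →
      n * h ≤ HH μ' D) : μ' = μ := by
  have := H.prob
  exact (H.ergodic hα).eq_of_absolutelyContinuous hμ' (H.ac hα hμ' hH)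

lemma GM.sing (H : GM f α h μ C c m) (hα : IsExpansiveWith f α) {p : X} (hp : f p = p)
    (h0 : μ {p} ≠ 0) (x : X) : x = p := by
  have := H.prob
  have hα0 := hα.1
  have hinv : f ⁻¹' {p} = {p} := by
    ext y
    simp only [mem_preimage, mem_singleton_iff]
    constructor
    · intro hy; exact f.injective (hy.trans hp.symm)
    · rintro rfl; exact hp
  have h1 : μ {p}ᶜ = 0 := by
    rcases (H.ergodic hα).toPreErgodic.measure_self_or_compl_eq_zero (measurableSet_singleton p) hinv
      with h | h
    · exact absurd h h0
    · exact h
  refine hα.2 x p fun n => ?_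
  by_contra hcon
  push Not at hcon
  have hl := H.lower1 1 (zIter f n x)
  have hpz : zIter f n p = p := by
    have key : ∀ (g : X ≃ₜ X), g p = p → ∀ k : ℕ, g^[k] p = p := fun g hg k =>
      Function.iterate_fixed hg k
    cases n with
    | ofNat n => exact key f hp n
    | negSucc n => exact key f.symm (by rw [Homeomorph.symm_apply_eq]; exact hp.symm) (n + 1)
  rw [hpz] at hcon
  have : μ.real {z | BC f 1 (α / 6) z (zIter f n x)} = 0 := by
    rw [measureReal_eq_zero_iff]
    refine measure_mono_null ?_ h1
    intro z hz hzp
    rw [mem_singleton_iff] at hzp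
    have := hz 0 (by norm_num)
    rw [hzp] at this
    simp only [Function.iterate_zero, id] at this
    rw [dist_comm] at this
    linarith
  rw [this] at hl
  have : 0 < c * Real.exp (-((1 : ℕ) * h)) := mul_pos H.hc (Real.exp_pos _)
  linarith

end G

end Blow

open MeasureTheory Filter Topology Set
open scoped ENNReal NNReal
open Samva

namespace Blow

lemma log_div_eq {a : ℝ} (ha : 0 < a) (n : ℕ) :
    ENNReal.log (ENNReal.ofReal a) / (n : EReal) = ((Real.log a / n : ℝ) : EReal) := by
  rw [ENNReal.log_ofReal_of_pos ha, EReal.coe_div]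
  rfl

lemma tendsto_aux (C b : ℝ) : Tendsto (fun n : ℕ => (((Real.log C + n * b) / n : ℝ) : EReal)) atTop
    (𝓝 (b : EReal)) := by
  refine (continuous_coe_real_ereal.tendsto b).comp ?_
  have h1 : Tendsto (fun n : ℕ => Real.log C / (n : ℝ)) atTop (𝓝 0) :=
    tendsto_const_div_atTop_nhds_zero_nat _
  have h2 := h1.add_const b
  rw [zero_add] at h2
  refine h2.congr' ?_
  filter_upwards [eventually_gt_atTop 0] with n hn
  have : (n : ℝ) ≠ 0 := by positivity
  field_simp

lemma limsup_le_of {a : ℕ → ℕ} (ha : ∀ n, 1 ≤ a n) {C b : ℝ} (hC : 0 < C)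
    (h : ∀ n : ℕ, (a n : ℝ) ≤ C * Real.exp (n * b)) :
    limsup (fun n : ℕ => ENNReal.log (a n : ℝ≥0∞) / (n : EReal)) atTop ≤ b := by
  rw [← (tendsto_aux C b).limsup_eq]
  refine limsup_le_limsup (Eventually.of_forall fun n => ?_)
  have ha0 : (0 : ℝ) < a n := by exact_mod_cast ha n
  beta_reduce
  rw [← ENNReal.ofReal_natCast, log_div_eq ha0, EReal.coe_le_coe_iff]
  refine div_le_div_of_nonneg_right ?_ (Nat.cast_nonneg n)
  have := Real.log_le_log ha0 (h n)
  rwa [Real.log_mul hC.ne' (Real.exp_pos _).ne', Real.log_exp] at this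

lemma le_limsup_of {a : ℕ → ℕ} {C b : ℝ} (hC : 0 < C)
    (h : ∀ n : ℕ, C * Real.exp (n * b) ≤ (a n : ℝ)) :
    b ≤ limsup (fun n : ℕ => ENNReal.log (a n : ℝ≥0∞) / (n : EReal)) atTop := by
  rw [← (tendsto_aux C b).limsup_eq]
  refine limsup_le_limsup (Eventually.of_forall fun n => ?_)
  have h0 : 0 < C * Real.exp (n * b) := mul_pos hC (Real.exp_pos _)
  have ha0 : (0 : ℝ) < a n := h0.trans_le (h n)
  beta_reduce
  rw [← ENNReal.ofReal_natCast, log_div_eq ha0, EReal.coe_le_coe_iff]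
  refine div_le_div_of_nonneg_right ?_ (Nat.cast_nonneg n)
  have := Real.log_le_log h0 (h n)
  rwa [Real.log_mul hC.ne' (Real.exp_pos _).ne', Real.log_exp] at this

section G

variable {X : Type*} [MetricSpace X] [CompactSpace X]

lemma small_growth {g : X → X} (hg : Continuous g) {B : Set X} (h0 : relEntropy g B = 0) {ε η : ℝ}
    (hε : 0 < ε) (hη : 0 < η) : ∃ m : ℕ, 0 < m ∧ (sN g B m ε : ℝ) ≤ Real.exp (η * m) := by
  have h1 : limsup (fun n : ℕ => ENNReal.log (sepCard g B n ε) / (n : EReal)) atTop ≤ 0 := by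
    rw [← h0]
    exact le_iSup₂ (f := fun (ε : ℝ) (_ : 0 < ε) =>
      limsup (fun n : ℕ => ENNReal.log (sepCard g B n ε) / (n : EReal)) atTop) ε hε
  have h2 : limsup (fun n : ℕ => ENNReal.log (sepCard g B n ε) / (n : EReal)) atTop < (η : EReal) :=
    lt_of_le_of_lt h1 (by exact_mod_cast hη)
  have h3 := eventually_lt_of_limsup_lt h2
  obtain ⟨m, hm, hm0⟩ := (h3.and (eventually_gt_atTop 0)).exists
  refine ⟨m, hm0, ?_⟩
  rw [sepCard_eq hg B m hε] at hm
  rcases Nat.eq_zero_or_pos (sN g B m ε) with hz | hz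
  · rw [hz]; simp [Real.exp_nonneg]
  have hz' : (0 : ℝ) < sN g B m ε := by exact_mod_cast hz
  rw [← ENNReal.ofReal_natCast, log_div_eq hz', EReal.coe_lt_coe_iff,
    div_lt_iff₀ (by exact_mod_cast hm0)] at hm
  exact ((Real.log_lt_iff_lt_exp hz').1 hm).le

/-- The factor map set-up. -/
structure Fac (f g : X ≃ₜ X) (π : X → X) (B : Set X) (p : X) : Prop where
  cont : Continuous π
  comm : ∀ x, π (g x) = f (π x)
  fib : ∀ x, π x = p ↔ x ∈ B
  inj : ∀ x y, x ∉ B → π x = π y → x = y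
  surj : Function.Surjective π
  ent : relEntropy g B = 0

variable {f g : X ≃ₜ X} {π : X → X} {B : Set X} {p : X}

lemma Fac.comm_iter (H : Fac f g π B p) (n : ℕ) (x : X) : π (g^[n] x) = f^[n] (π x) := by
  induction n with
  | zero => rfl
  | succ n ih => rw [Function.iterate_succ_apply', Function.iterate_succ_apply', H.comm, ih]

lemma Fac.tube (H : Fac f g π B p) {y : X} {W : Set X} (hW : IsOpen W)
    (hy : ∀ x, π x = y → x ∈ W) : ∃ V, IsOpen V ∧ y ∈ V ∧ π ⁻¹' V ⊆ W := by
  refine ⟨(π '' Wᶜ)ᶜ, ((hW.isClosed_compl.isCompact.image H.cont).isClosed).isOpen_compl, ?_, ?_⟩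
  · rintro ⟨x, hx, rfl⟩
    exact hx (hy x rfl)
  · intro x hx
    by_contra hc
    exact hx ⟨x, hc, rfl⟩

lemma Fac.count (H : Fac f g π B p) {δ η : ℝ} (hδ : 0 < δ) (hη : 0 < η) :
    ∃ δ' > 0, ∃ L : ℝ, 0 < L ∧ ∀ (n : ℕ) (E : Finset X), IsSep g n δ (E : Set X) →
      (∀ x ∈ E, ∀ y ∈ E, ∀ j < n, dist (π (g^[j] x)) (π (g^[j] y)) ≤ δ') →
      (E.card : ℝ) ≤ L * Real.exp (η * n) := by
  classical
  obtain ⟨m, hm0, hm⟩ := small_growth g.continuous H.ent (ε := δ / 4) (by linarith) hη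
  obtain ⟨EB, b1, b2, b3, b4⟩ := exists_sN g.continuous B m (ε := δ / 4) (by linarith)
  rw [← b3] at hm
  set W : Set X := ⋃ e ∈ EB, {z | ∀ j < m, dist (g^[j] z) (g^[j] e) < δ / 2} with hW
  have hWo : IsOpen W := by
    refine isOpen_biUnion fun e _ => ?_
    have : {z | ∀ j < m, dist (g^[j] z) (g^[j] e) < δ / 2} =
        ⋂ j ∈ Finset.range m, {z | dist (g^[j] z) (g^[j] e) < δ / 2} := by
      ext; simp
    rw [this]
    exact isOpen_biInter_finset fun j _ =>
      isOpen_lt ((g.continuous.iterate j).dist continuous_const) continuous_const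
  have hBW : B ⊆ W := by
    intro x hx
    obtain ⟨e, he, hxe⟩ := b4 x hx
    refine mem_iUnion₂.2 ⟨e, he, fun j hj => ?_⟩
    have := hxe j hj
    linarith
  have hV : ∀ y : X, ∃ V, IsOpen V ∧ y ∈ V ∧
      (π ⁻¹' V ⊆ W ∨ ∃ x, π ⁻¹' V ⊆ Metric.ball x (δ / 2)) := by
    intro y
    rcases eq_or_ne y p with rfl | hy
    · obtain ⟨V, v1, v2, v3⟩ := H.tube hWo (fun x hx => hBW ((H.fib x).1 hx))
      exact ⟨V, v1, v2, Or.inl v3⟩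
    · obtain ⟨x, rfl⟩ := H.surj y
      have hxB : x ∉ B := fun h => hy ((H.fib x).2 h)
      obtain ⟨V, v1, v2, v3⟩ := H.tube (y := π x) (W := Metric.ball x (δ / 2)) Metric.isOpen_ball
        (fun z hz => by rw [← H.inj x z hxB hz.symm]; exact Metric.mem_ball_self (by linarith))
      exact ⟨V, v1, v2, Or.inr ⟨x, v3⟩⟩
  choose V v1 v2 v3 using hV
  obtain ⟨δ', d1, d2⟩ := lebesgue_number_lemma_of_metric isCompact_univ v1
    (fun y _ => mem_iUnion.2 ⟨y, v2 y⟩)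
  refine ⟨δ' / 2, by linarith, EB.card + 1, by positivity, ?_⟩
  intro n
  induction n using Nat.strong_induction_on with
  | _ n ih =>
  intro E hE hcl
  rw [isSep_iff] at hE
  have hL1 : (1 : ℝ) ≤ EB.card + 1 := by simp
  have helper : ∀ k : ℕ, 0 < k → k ≤ n → ∀ F : Finset X, F ⊆ E →
      (∀ x ∈ F, ∀ y ∈ F, BC g k δ x y) →
      (F.card : ℝ) ≤ (EB.card + 1) * Real.exp (η * ((n : ℝ) - k)) := by
    intro k hk hkn F hF hFk
    have := ih (n - k) (by omega) (F.image g^[k]) (isSep_iff.2 (by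
      intro x hx y hy hxy
      simp only [Finset.coe_image, mem_image, Finset.mem_coe] at hx hy
      obtain ⟨x, hx, rfl⟩ := hx
      obtain ⟨y, hy, rfl⟩ := hy
      congr 1
      refine hE x (hF hx) y (hF hy) fun j hj => ?_
      rcases lt_or_ge j k with hjk | hjk
      · exact hFk x hx y hy j hjk
      · obtain ⟨l, rfl⟩ := Nat.exists_eq_add_of_le' hjk
        rw [Function.iterate_add_apply, Function.iterate_add_apply]
        exact hxy l (by omega))) (by
      intro x hx y hy j hj
      simp only [Finset.mem_image] at hx hy
      obtain ⟨x, hx, rfl⟩ := hx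
      obtain ⟨y, hy, rfl⟩ := hy
      rw [← Function.iterate_add_apply, ← Function.iterate_add_apply]
      exact hcl x (hF hx) y (hF hy) _ (by omega))
    rw [Finset.card_image_of_injective _ (g.injective.iterate k), Nat.cast_sub hkn] at this
    exact this
  rcases Nat.eq_zero_or_pos n with hn0 | hn0
  · subst hn0
    have := card_le_one_of (E := E) fun x hx y hy => hE x hx y hy fun j hj => by omega
    simp only [Nat.cast_zero, mul_zero, Real.exp_zero, mul_one]
    linarith
  rcases E.eq_empty_or_nonempty with rfl | ⟨x₀, hx₀⟩
  · simp; positivity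
  obtain ⟨i, hi⟩ := d2 (π x₀) (mem_univ _)
  have hEV : ∀ x ∈ E, x ∈ π ⁻¹' (V i) := by
    intro x hx
    apply hi
    have := hcl x hx x₀ hx₀ 0 hn0
    simp only [Function.iterate_zero, id] at this
    rw [Metric.mem_ball]
    linarith
  rcases v3 i with h3 | ⟨z, h3⟩
  · have hch : ∀ x, ∃ e, x ∈ E → e ∈ EB ∧ ∀ j < m, dist (g^[j] x) (g^[j] e) < δ / 2 := by
      intro x
      by_cases hx : x ∈ E
      · obtain ⟨e, he, h⟩ := mem_iUnion₂.1 (h3 (hEV x hx))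
        exact ⟨e, fun _ => ⟨he, h⟩⟩
      · exact ⟨x, fun h => absurd h hx⟩
    choose φ hφ using hch
    have hfib : ∀ F : Finset X, F ⊆ E → ∀ b, (∀ x ∈ F, φ x = b) →
        ∀ x ∈ F, ∀ y ∈ F, BC g m δ x y := by
      intro F hF b hb x hx y hy j hj
      have a1 := (hφ x (hF hx)).2 j hj
      have a2 := (hφ y (hF hy)).2 j hj
      rw [hb x hx] at a1
      rw [hb y hy] at a2
      have := dist_triangle_right (g^[j] x) (g^[j] y) (g^[j] b)
      linarith
    rcases le_or_gt n m with hnm | hnm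
    · have := card_fiber_le E EB φ (fun x hx => (hφ x hx).1) (c := 1) (by
        intro b _ F hF hb
        refine card_le_one_of fun x hx y hy => hE x (hF hx) y (hF hy) fun j hj => ?_
        exact hfib F hF b hb x hx y hy j (by omega))
      have he : 1 ≤ Real.exp (η * n) := Real.one_le_exp (by positivity)
      have : (0 : ℝ) ≤ EB.card := Nat.cast_nonneg _
      nlinarith
    · have := card_fiber_le E EB φ (fun x hx => (hφ x hx).1)
        (c := (EB.card + 1) * Real.exp (η * ((n : ℝ) - m))) (by
        intro b _ F hF hb
        exact helper m hm0 hnm.le F hF (hfib F hF b hb))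
      refine this.trans ?_
      calc _ ≤ Real.exp (η * m) * ((EB.card + 1) * Real.exp (η * ((n : ℝ) - m))) := by gcongr
        _ = (EB.card + 1) * (Real.exp (η * m) * Real.exp (η * ((n : ℝ) - m))) := by ring
        _ = _ := by rw [← Real.exp_add]; congr 2; ring
  · have := helper 1 one_pos hn0 E (Finset.Subset.refl _) (by
      intro x hx y hy j hj
      obtain rfl : j = 0 := by omega
      have a1 := h3 (hEV x hx)
      have a2 := h3 (hEV y hy)
      rw [Metric.mem_ball] at a1 a2
      have := dist_triangle_right x y z
      simp only [Function.iterate_zero, id]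
      linarith)
    refine this.trans ?_
    gcongr
    push_cast
    linarith

lemma Fac.topEntropy_eq [Nonempty X] (H : Fac f g π B p) {α : ℝ} (hα : IsExpansiveWith f α) {h K : ℝ}
    (hK : 1 ≤ K)
    (hg : ∀ n : ℕ, Real.exp (n * h) ≤ K * sN f univ n α ∧
      sN f univ n α ≤ K * Real.exp (n * h)) : topEntropy g = (h : EReal) := by
  classical
  have hα0 := hα.1
  have hK0 : 0 < K := by linarith
  apply le_antisymm
  · refine iSup₂_le fun ε hε => ?_
    simp only [sepCard_eq g.continuous univ _ hε]
    refine EReal.le_of_forall_lt_iff_le.1 fun z hz => ?_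
    have hz' : h < z := by exact_mod_cast hz
    obtain ⟨δ', d1, L, L0, hL⟩ := H.count hε (η := z - h) (by linarith)
    obtain ⟨C, hC1, hC⟩ := scale_change hα (δ := δ' / 2) (by linarith)
    refine limsup_le_of (C := K * C * L) (b := z)
      (fun n => sN_pos g.continuous univ_nonempty n hε) (by positivity) fun n => ?_
    obtain ⟨E, -, e2, e3, -⟩ := exists_sN g.continuous univ n hε
    obtain ⟨S, -, -, s3, s4⟩ := exists_sN f.continuous univ n (ε := δ' / 2) (by linarith)
    choose φ p1 p2 using fun x => s4 (π x) (mem_univ _)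
    have := card_fiber_le E S φ (fun x _ => p1 x) (c := L * Real.exp ((z - h) * n)) (by
      intro b _ F hF hb
      refine hL n F (e2.mono (Finset.coe_subset.2 hF)) fun x hx y hy j hj => ?_
      rw [H.comm_iter, H.comm_iter]
      have a1 := p2 x j hj
      have a2 := p2 y j hj
      rw [hb x hx] at a1
      rw [hb y hy] at a2
      have := dist_triangle_right (f^[j] (π x)) (f^[j] (π y)) (f^[j] b)
      linarith)
    rw [e3, s3] at this
    refine this.trans ?_
    calc _ ≤ (C * (K * Real.exp (n * h))) * (L * Real.exp ((z - h) * n)) := by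
          gcongr
          exact (hC n).trans (by gcongr; exact (hg n).2)
      _ = K * C * L * (Real.exp (n * h) * Real.exp ((z - h) * n)) := by ring
      _ = _ := by rw [← Real.exp_add]; congr 2; ring
  · obtain ⟨ε, hε, hπ⟩ := Metric.uniformContinuous_iff.1
      (CompactSpace.uniformContinuous_of_continuous H.cont) α hα0
    refine le_trans ?_ (le_iSup₂ (f := fun (ε : ℝ) (_ : 0 < ε) =>
      limsup (fun n : ℕ => ENNReal.log (sepCard g univ n ε) / (n : EReal)) atTop) (ε / 2)
      (half_pos hε))
    simp only [sepCard_eq g.continuous univ _ (half_pos hε)]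
    refine le_limsup_of (C := 1 / K) (by positivity) fun n => ?_
    obtain ⟨E, -, e2, e3, -⟩ := exists_sN f.continuous univ n hα0
    choose s hs using H.surj
    have hinj : Function.Injective s := fun a b hab => by rw [← hs a, ← hs b, hab]
    have := le_sN g.continuous (n := n) (half_pos hε) (E := E.image s) (subset_univ _)
      (isSep_iff.2 (by
        intro x hx y hy hxy
        simp only [Finset.coe_image, mem_image, Finset.mem_coe] at hx hy
        obtain ⟨x, hx, rfl⟩ := hx
        obtain ⟨y, hy, rfl⟩ := hy
        congr 1
        refine isSep_iff.1 e2 x hx y hy fun j hj => ?_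
        have := hπ (lt_of_le_of_lt (hxy j hj) (by linarith : ε / 2 < ε))
        rw [H.comm_iter, H.comm_iter, hs, hs] at this
        exact this.le))
    rw [Finset.card_image_of_injective _ hinj, e3] at this
    calc _ ≤ 1 / K * (K * sN f univ n α) := by gcongr; exact (hg n).1
      _ = sN f univ n α := by field_simp
      _ ≤ _ := by exact_mod_cast this

end G

end Blow

open MeasureTheory Filter Topology Set
open scoped ENNReal NNReal
open Samva

namespace Blow

section G

variable {X : Type*} [MetricSpace X] [CompactSpace X] [MeasurableSpace X] [BorelSpace X]

lemma exists_W {ι : Type*} [Fintype ι] {ν : Measure X} [IsProbabilityMeasure ν] {cl : X → ι}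
    (hcl : MF cl) {η : ℝ} (hη : 0 < η) :
    ∃ W : X → Option ι, MF W ∧ HH ν W ≤ η ∧ ∃ δ > 0,
      (∀ x y, W x = W y → dist x y ≤ δ → cl x = cl y) := by
  classical
  set Λ := Real.log (Fintype.card ι + 1) with hΛ
  obtain ⟨t, ht, ht'⟩ : ∃ t > 0, ∀ r : ℝ, 0 ≤ r → r < t →
      Real.negMulLog (1 - r) + (Real.negMulLog r + r * Λ) < η := by
    have hc : Continuous fun r : ℝ => Real.negMulLog (1 - r) + (Real.negMulLog r + r * Λ) := by
      have := Real.continuous_negMulLog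
      fun_prop
    obtain ⟨t, h1, h2⟩ := Metric.continuous_iff.1 hc 0 η hη
    refine ⟨t, h1, fun r hr hrt => ?_⟩
    have := h2 r (by rw [Real.dist_eq, sub_zero, abs_of_nonneg hr]; exact hrt)
    simp only [Real.dist_eq, sub_zero, Real.negMulLog_one, Real.negMulLog_zero, zero_mul, add_zero]
      at this
    exact lt_of_abs_lt this
  have hK : ∀ a, ∃ K, K ⊆ cl ⁻¹' {a} ∧ IsCompact K ∧
      ν (cl ⁻¹' {a} \ K) < ENNReal.ofReal (t / (Fintype.card ι + 1)) := fun a =>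
    (hcl a).exists_isCompact_sdiff_lt (measure_ne_top _ _)
      (by
        have : 0 < t / (Fintype.card ι + 1) := by positivity
        simpa using this)
  choose K k1 k2 k3 using hK
  have k3' : ∀ a, ν.real (cl ⁻¹' {a} \ K a) ≤ t / (Fintype.card ι + 1) := fun a =>
    ((ENNReal.lt_ofReal_iff_toReal_lt (measure_ne_top _ _)).1 (k3 a)).le
  have kcl : ∀ a x, x ∈ K a → cl x = a := fun a x hx => k1 a hx
  set G : Set X := ⋃ a, K a with hG
  have hGm : MeasurableSet G := MeasurableSet.iUnion fun a => (k2 a).measurableSet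
  have hGr : ν.real Gᶜ < t := by
    have hsub : Gᶜ ⊆ ⋃ a ∈ (Finset.univ : Finset ι), (cl ⁻¹' {a} \ K a) := by
      intro x hx
      refine mem_iUnion₂.2 ⟨cl x, Finset.mem_univ _, rfl, fun h => hx (mem_iUnion.2 ⟨_, h⟩)⟩
    calc ν.real Gᶜ ≤ ν.real (⋃ a ∈ (Finset.univ : Finset ι), (cl ⁻¹' {a} \ K a)) :=
          measureReal_mono hsub (measure_ne_top _ _)
      _ ≤ ∑ a ∈ (Finset.univ : Finset ι), ν.real (cl ⁻¹' {a} \ K a) :=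
          measureReal_biUnion_finset_le _ _
      _ ≤ Fintype.card ι * (t / (Fintype.card ι + 1)) := by
          have := Finset.sum_le_card_nsmul Finset.univ (fun a => ν.real (cl ⁻¹' {a} \ K a)) _
            (fun a _ => k3' a)
          simpa using this
      _ < t := by
          rw [mul_div_assoc', div_lt_iff₀ (by positivity)]
          linarith
  let W : X → Option ι := fun x => if x ∈ G then none else some (cl x)
  have hWsome : ∀ a, W ⁻¹' {some a} = Gᶜ ∩ cl ⁻¹' {a} := by
    intro a
    ext x
    by_cases hx : x ∈ G <;> simp [W, hx]
  have hWnone : W ⁻¹' {none} = G := by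
    ext x
    by_cases hx : x ∈ G <;> simp [W, hx]
  have hWm : MF W := by
    intro a
    cases a with
    | none => rw [hWnone]; exact hGm
    | some a => rw [hWsome]; exact hGm.compl.inter (hcl a)
  refine ⟨W, hWm, ?_, ?_⟩
  · have hs : ∑ a, ν.real (W ⁻¹' {some a}) = ν.real Gᶜ := by
      have h1 := sum_real_preimage (ν := ν) hWm
      rw [Fintype.sum_option, hWnone] at h1
      have h2 := probReal_compl_eq_one_sub (μ := ν) hGm
      linarith
    have h1 : HH ν W = Real.negMulLog (ν.real G) +
        ∑ a, Real.negMulLog (ν.real (W ⁻¹' {some a})) := by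
      unfold HH
      rw [Fintype.sum_option, hWnone]
    have h2 := sum_negMulLog_le Finset.univ (fun a => ν.real (W ⁻¹' {some a}))
      (fun _ _ => measureReal_nonneg) (c := Fintype.card ι + 1) (by positivity) (by simp)
    rw [hs] at h2
    have h3 := ht' (ν.real Gᶜ) measureReal_nonneg hGr
    have h4 : ν.real G = 1 - ν.real Gᶜ := by
      rw [probReal_compl_eq_one_sub hGm]; ring
    rw [← h4] at h3
    linarith
  · have hd : ∀ a, ∃ δ > 0, ∀ x ∈ K a, ∀ y, dist y x < δ → y ∈ (⋃ b, ⋃ (_ : b ≠ a), K b)ᶜ := by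
      intro a
      refine exists_nhd (k2 a) ?_ ?_
      · refine (IsCompact.isClosed ?_).isOpen_compl
        exact isCompact_iUnion fun b => isCompact_iUnion fun _ => k2 b
      · intro x hx hx'
        simp only [mem_iUnion] at hx'
        obtain ⟨b, hb, hxb⟩ := hx'
        exact hb ((kcl b x hxb).symm.trans (kcl a x hx))
    choose δ d1 d2 using hd
    have hev : ∀ᶠ r in 𝓝[>] (0 : ℝ), ∀ a, r < δ a :=
      eventually_all.2 fun a => mem_nhdsWithin_of_mem_nhds (Iio_mem_nhds (d1 a))
    obtain ⟨r, hr, hr0⟩ := (hev.and self_mem_nhdsWithin).exists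
    refine ⟨r, hr0, fun x y hxy hdist => ?_⟩
    by_cases hx : x ∈ G
    · by_cases hy : y ∈ G
      · obtain ⟨a, ha⟩ := mem_iUnion.1 hx
        obtain ⟨b, hb⟩ := mem_iUnion.1 hy
        by_contra hne
        rw [kcl a x ha, kcl b y hb] at hne
        refine d2 a x ha y ?_ (mem_iUnion₂.2 ⟨b, Ne.symm hne, hb⟩)
        rw [dist_comm]
        exact lt_of_le_of_lt hdist (hr a)
      · simp [W, hx, hy] at hxy
    · by_cases hy : y ∈ G
      · simp [W, hx, hy] at hxy
      · simpa [W, hx, hy] using hxy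

variable {f g : X ≃ₜ X} {π : X → X} {B : Set X} {p : X}

lemma Fac.main_est (H : Fac f g π B p) {α : ℝ} (hα : IsExpansiveWith f α) {ν : Measure X}
    [IsProbabilityMeasure ν] (hν : MeasurePreserving g ν ν) {ι κ : Type*} [Fintype ι] [Fintype κ]
    {cl : X → ι} (hcl : MF cl) {n : ℕ} (hn : 0 < n) {D : X → κ} (hD : MF D)
    (hDB : ∀ x y, D x = D y → BC f n α x y) {η : ℝ} (hη : 0 < η) :
    ∃ R : ℝ, ∀ k : ℕ, HH ν (fun x (i : Fin (k * n)) => cl (g^[i] x)) ≤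
      k * HH ν (D ∘ π) + (k * n : ℕ) * η + R := by
  classical
  haveI : Nonempty X := nonempty_of_isProbabilityMeasure ν
  obtain ⟨W, w1, w2, δ, d0, w3⟩ := exists_W (ν := ν) hcl (half_pos hη)
  obtain ⟨δ', d1, L, L0, hL⟩ := H.count d0 (half_pos hη)
  obtain ⟨k0, hk0⟩ := unif_exp_fwd hα d1
  set Λ := Real.log (Fintype.card (Option ι)) with hΛ
  have hΛ0 : 0 ≤ Λ := Real.log_nonneg (by simp)
  refine ⟨Real.log L + 2 * k0 * Λ, fun k => ?_⟩
  set N := k * n with hN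
  have hgm : ∀ j, Measurable g^[j] := fun j => (g.continuous.iterate j).measurable
  let V : Fin N → X → Option ι := fun i x =>
    if i.1 < k0 ∨ N ≤ i.1 + k0 then some (cl (g^[i] x)) else W (g^[i] x)
  have hsc : MF fun x => some (cl x) := hcl.comp some
  have hV : ∀ i, MF (V i) := by
    intro i
    by_cases hi : i.1 < k0 ∨ N ≤ i.1 + k0
    · have : V i = (fun x => some (cl x)) ∘ g^[i] := by funext x; simp only [V, if_pos hi]; rfl
      rw [this]
      exact hsc.comp_meas (hgm _)
    · have : V i = W ∘ g^[i] := by funext x; simp only [V, if_neg hi]; rfl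
      rw [this]
      exact w1.comp_meas (hgm _)
  have hDπ : MF (D ∘ π) := fun a => H.cont.measurable (hD a)
  have hX : MF (fun x (i : Fin N) => cl (g^[i] x)) :=
    MF.pi (X := fun (i : Fin N) x => cl (g^[i] x)) fun i => hcl.comp_meas (hgm i)
  have hY1m : ∀ j : Fin k, MF ((D ∘ π) ∘ g^[j.1 * n]) := fun j => hDπ.comp_meas (hgm _)
  have hY1 : MF (fun x (j : Fin k) => ((D ∘ π) ∘ g^[j.1 * n]) x) := MF.pi hY1m
  have hY2 : MF (fun x (i : Fin N) => V i x) := MF.pi hV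
  have hcount := HH_prod_count (ν := ν) hX (hY1.prodMk hY2) (c := L * Real.exp (η / 2 * N))
    (by positivity) (by
    rintro ⟨b1, b2⟩ S hS
    choose! ω o1 o2 using hS
    have o3 : ∀ a ∈ S, ∀ j : Fin k, D (π (g^[j.1 * n] (ω a))) = b1 j := fun a ha j =>
      congrFun (congrArg Prod.fst (o2 a ha)) j
    have o4 : ∀ a ∈ S, ∀ i : Fin N, V i (ω a) = b2 i := fun a ha i =>
      congrFun (congrArg Prod.snd (o2 a ha)) i
    have hinj : Set.InjOn (fun a => g^[k0] (ω a)) (S : Set (Fin N → ι)) := by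
      intro a ha a' ha' h
      have := g.injective.iterate k0 h
      rw [← o1 a ha, ← o1 a' ha', this]
    have hBC : ∀ a ∈ S, ∀ a' ∈ S, BC f N α (π (ω a)) (π (ω a')) := by
      intro a ha a' ha' j hj
      have hjn : j / n < k := Nat.div_lt_of_lt_mul (by rw [mul_comm]; exact hj)
      have := hDB _ _ ((o3 a ha ⟨j / n, hjn⟩).trans (o3 a' ha' ⟨j / n, hjn⟩).symm) (j % n)
        (Nat.mod_lt _ hn)
      simp only at this
      rw [H.comm_iter, H.comm_iter, ← Function.iterate_add_apply, ← Function.iterate_add_apply,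
        Nat.mod_add_div'] at this
      exact this
    have := hL (N - 2 * k0) (S.image fun a => g^[k0] (ω a)) (isSep_iff.2 (by
      intro x hx y hy hxy
      simp only [Finset.coe_image, mem_image, Finset.mem_coe] at hx hy
      obtain ⟨a, ha, rfl⟩ := hx
      obtain ⟨a', ha', rfl⟩ := hy
      have haa : a = a' := by
        funext i
        rw [← o1 a ha, ← o1 a' ha']
        simp only
        have hVi := (o4 a ha i).trans (o4 a' ha' i).symm
        by_cases hi : i.1 < k0 ∨ N ≤ i.1 + k0
        · simp only [V, if_pos hi] at hVi
          exact Option.some_injective _ hVi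
        · simp only [V, if_neg hi] at hVi
          push Not at hi
          refine w3 _ _ hVi ?_
          have := hxy (i.1 - k0) (by omega)
          rw [← Function.iterate_add_apply, ← Function.iterate_add_apply,
            Nat.sub_add_cancel hi.1] at this
          exact this
      rw [haa])) (by
      intro x hx y hy j hj
      simp only [Finset.mem_image] at hx hy
      obtain ⟨a, ha, rfl⟩ := hx
      obtain ⟨a', ha', rfl⟩ := hy
      rw [← Function.iterate_add_apply, ← Function.iterate_add_apply, H.comm_iter, H.comm_iter]
      exact (hk0 N _ _ (hBC a ha a' ha') (j + k0) (by omega) (by omega)).le)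
    rw [Finset.card_image_of_injOn hinj] at this
    refine this.trans ?_
    gcongr
    omega)
  rw [Real.log_mul L0.ne' (Real.exp_pos _).ne', Real.log_exp] at hcount
  have e1 := HH_prod_le (ν := ν) hY1 hY2
  have e2 := HH_pi_le (ν := ν) k (fun j => (D ∘ π) ∘ g^[j.1 * n]) hY1m
  have e3 := HH_pi_le (ν := ν) N V hV
  have e2' : ∑ j : Fin k, HH ν ((D ∘ π) ∘ g^[j.1 * n]) = k * HH ν (D ∘ π) := by
    rw [Finset.sum_congr rfl fun j _ => HH_comp_meas hDπ (hν.iterate _)]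
    simp
  have e3' : ∑ i : Fin N, HH ν (V i) ≤ N * (η / 2) + 2 * k0 * Λ := by
    have hb : ∀ i : Fin N, HH ν (V i) ≤ η / 2 +
        ((if i.1 < k0 then Λ else 0) + (if N ≤ i.1 + k0 then Λ else 0)) := by
      intro i
      by_cases hi : i.1 < k0 ∨ N ≤ i.1 + k0
      · have h1 : HH ν (V i) ≤ Λ := HH_le_log (hV i) (by simp; positivity) le_rfl
        rcases hi with hi | hi
        · rw [if_pos hi]
          split_ifs <;> linarith
        · rw [if_pos hi]
          split_ifs <;> linarith
      · have : V i = W ∘ g^[i] := by funext x; simp only [V, if_neg hi]; rfl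
        rw [this, HH_comp_meas w1 (hν.iterate _)]
        split_ifs <;> linarith
    refine (Finset.sum_le_sum fun i _ => hb i).trans ?_
    rw [Finset.sum_add_distrib, Finset.sum_add_distrib,
      Fin.sum_univ_eq_sum_range (fun i => if i < k0 then Λ else 0),
      Fin.sum_univ_eq_sum_range (fun i => if N ≤ i + k0 then Λ else 0),
      ← Finset.sum_filter, ← Finset.sum_filter]
    simp only [Finset.sum_const, Finset.card_univ, Fintype.card_fin, nsmul_eq_mul]
    have c1 : ((Finset.range N).filter fun i => i < k0).card ≤ k0 := by
      have : ((Finset.range N).filter fun i => i < k0) ⊆ Finset.range k0 := by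
        intro i hi; simp at hi ⊢; exact hi.2
      simpa using Finset.card_le_card this
    have c2 : ((Finset.range N).filter fun i => N ≤ i + k0).card ≤ k0 := by
      have : ((Finset.range N).filter fun i => N ≤ i + k0) ⊆ Finset.Ico (N - k0) N := by
        intro i hi; simp at hi ⊢; omega
      have := Finset.card_le_card this
      rw [Nat.card_Ico] at this
      omega
    have c1' : (((Finset.range N).filter fun i => i < k0).card : ℝ) ≤ k0 := by exact_mod_cast c1
    have c2' : (((Finset.range N).filter fun i => N ≤ i + k0).card : ℝ) ≤ k0 := by exact_mod_cast c2
    nlinarith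
  rw [e2'] at e2
  have : HH ν (fun x (i : Fin N) => cl (g^[i] x)) ≤ k * HH ν (D ∘ π) +
      (N * (η / 2) + 2 * k0 * Λ) + (Real.log L + η / 2 * N) := by
    refine hcount.trans ?_
    have e4 : HH ν (fun ω => ((fun x (j : Fin k) => ((D ∘ π) ∘ g^[j.1 * n]) x) ω,
      (fun x (i : Fin N) => V i x) ω)) ≤ k * HH ν (D ∘ π) + (N * (η / 2) + 2 * k0 * Λ) :=
      e1.trans (add_le_add e2 (e3.trans e3'))
    linarith
  linarith

lemma Fac.main_ineq (H : Fac f g π B p) {α : ℝ} (hα : IsExpansiveWith f α) {ν : Measure X}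
    [IsProbabilityMeasure ν] (hν : MeasurePreserving g ν ν) {ι κ : Type*} [Fintype ι] [Fintype κ]
    {cl : X → ι} (hcl : MF cl) {n : ℕ} (hn : 0 < n) {D : X → κ} (hD : MF D)
    (hDB : ∀ x y, D x = D y → BC f n α x y) {I : ℝ}
    (hI : ∀ N : ℕ, 0 < N → N * I ≤ HH ν (fun x (i : Fin N) => cl (g^[i] x))) :
    n * I ≤ HH ν (D ∘ π) := by
  refine le_of_forall_pos_le_add fun e he => ?_
  have hn' : (0 : ℝ) < n := by exact_mod_cast hn
  obtain ⟨R, hR⟩ := H.main_est hα hν hcl hn hD hDB (η := e / n) (by positivity)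
  by_contra hcon
  push Not at hcon
  obtain ⟨k, hk⟩ := exists_nat_gt (|R| / (n * I - (HH ν (D ∘ π) + e)))
  have hpos : 0 < n * I - (HH ν (D ∘ π) + e) := by linarith
  have hk0 : 0 < k := by
    have : (0 : ℝ) < k := lt_of_le_of_lt (by positivity) hk
    exact_mod_cast this
  rw [div_lt_iff₀ hpos] at hk
  have h1 := (hI (k * n) (by positivity)).trans (hR k)
  push_cast at h1
  have : (k : ℝ) * n * (e / n) = k * e := by field_simp
  rw [this] at h1
  have := le_abs_self R
  nlinarith

/-- name map of a partition -/
lemma exists_cl {P : Finset (Set X)} (hP : IsMPartition P) :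
    ∃ cl : X → P, ∀ x A, cl x = A ↔ x ∈ (A : Set X) := by
  obtain ⟨h1, h2, h3⟩ := hP
  have : ∀ x, ∃ A : P, x ∈ (A : Set X) := by
    intro x
    have : x ∈ ⋃₀ (P : Set (Set X)) := h3 ▸ mem_univ x
    obtain ⟨A, hA, hx⟩ := this
    exact ⟨⟨A, hA⟩, hx⟩
  choose cl hc using this
  refine ⟨cl, fun x A => ⟨fun h => h ▸ hc x, fun h => ?_⟩⟩
  by_contra hne
  have hd := h2 (cl x).2 A.2 (fun h => hne (Subtype.ext h))
  exact Set.disjoint_left.1 hd (hc x) h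

lemma dynH_eq {P : Finset (Set X)} {cl : X → P}
    (hcl : ∀ x A, cl x = A ↔ x ∈ (A : Set X)) (ν : Measure X) (g : X → X) (n : ℕ) :
    dynH ν g P n = HH ν (fun x (i : Fin n) => cl (g^[i] x)) := by
  unfold dynH HH
  refine Finset.sum_congr rfl fun A _ => ?_
  congr 2
  congr 1
  ext x
  simp only [mem_iInter, mem_preimage, mem_singleton_iff, funext_iff, hcl]

lemma Fac.entropy_le (H : Fac f g π B p) {α : ℝ} (hα : IsExpansiveWith f α) {ν : Measure X}
    [IsProbabilityMeasure ν] (hν : MeasurePreserving g ν ν) {κ : Type*} [Fintype κ]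
    {n : ℕ} (hn : 0 < n) {D : X → κ} (hD : MF D)
    (hDB : ∀ x y, D x = D y → BC f n α x y) :
    mEntropy g ν ≤ ((HH ν (D ∘ π) / n : ℝ) : EReal) := by
  have hn' : (0 : ℝ) < n := by exact_mod_cast hn
  refine iSup_le ?_
  rintro ⟨P, hP⟩
  obtain ⟨cl, hcl⟩ := exists_cl hP
  have hclm : MF cl := by
    intro A
    have : cl ⁻¹' {A} = (A : Set X) := by ext x; simp [hcl]
    rw [this]
    exact hP.1 _ A.2
  refine EReal.ge_of_forall_gt_iff_ge.1 fun I hI => ?_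
  have hI' : ∀ N : ℕ, 0 < N → N * I ≤ HH ν (fun x (i : Fin N) => cl (g^[i] x)) := by
    intro N hN
    obtain ⟨N, rfl⟩ := Nat.exists_eq_succ_of_ne_zero hN.ne'
    have h1 := hI.le.trans (iInf_le _ N)
    rw [EReal.coe_le_coe_iff, dynH_eq hcl, le_div_iff₀ (by positivity)] at h1
    push_cast
    linarith
  have := H.main_ineq hα hν hclm hn hD hDB hI'
  rw [EReal.coe_le_coe_iff, le_div_iff₀ hn']
  linarith

end G

end Blow

open MeasureTheory Filter Topology Set
open scoped ENNReal NNReal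
open Samva

namespace Blow

section G

variable {X : Type*} [MetricSpace X] [CompactSpace X] [MeasurableSpace X] [BorelSpace X]
variable {f g : X ≃ₜ X} {π : X → X} {B : Set X} {p : X} {α h K C c : ℝ} {m : ℕ} {μ : Measure X}

/-- linear growth comparison -/
lemma le_of_lin {a b R : ℝ} (hk : ∀ k : ℕ, 0 < k → k * a ≤ k * b + R) : a ≤ b := by
  by_contra hcon
  push Not at hcon
  obtain ⟨k, hk'⟩ := exists_nat_gt (|R| / (a - b))
  have hpos : 0 < a - b := by linarith
  have hk0 : 0 < k := by
    have : (0 : ℝ) < k := lt_of_le_of_lt (by positivity) hk'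
    exact_mod_cast this
  rw [div_lt_iff₀ hpos] at hk'
  have h1 := hk k hk0
  have := le_abs_self R
  nlinarith

lemma Fac.entropy_le_h (H : Fac f g π B p) (hα : IsExpansiveWith f α) (hK : 1 ≤ K)
    (hg : ∀ n : ℕ, Real.exp (n * h) ≤ K * sN f univ n α ∧
      sN f univ n α ≤ K * Real.exp (n * h)) {ν : Measure X} [IsProbabilityMeasure ν]
    (hν : MeasurePreserving g ν ν) : mEntropy g ν ≤ (h : EReal) := by
  have hα0 := hα.1
  obtain ⟨C1, hC1, hsc⟩ := scale_change hα (δ := α / 3) (by linarith)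
  refine EReal.ge_of_forall_gt_iff_ge.1 fun I hI => ?_
  rw [EReal.coe_le_coe_iff]
  refine le_of_lin (R := Real.log (C1 * K)) fun n hn => ?_
  have hn' : (0 : ℝ) < n := by exact_mod_cast hn
  obtain ⟨E, e1, e2, e3, e4⟩ := exists_sN f.continuous univ n (ε := α / 3) (by linarith)
  obtain ⟨D, D1, D2⟩ := exists_sel (ι := E) (fun e => {x | BC f n (α / 3) x e})
    (fun e => (isClosed_BC f.continuous _ _ _).measurableSet) (fun x => by
      obtain ⟨e, he, hx⟩ := e4 x (mem_univ _)
      exact ⟨⟨e, he⟩, hx⟩)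
  have h1 := H.entropy_le hα hν hn D1 (fun x y hxy => by
    have a1 := D2 x
    have a2 := D2 y
    rw [← hxy] at a2
    exact (BC.trans a1 (BC.symm a2)).mono (by linarith))
  have h2 := hI.le.trans h1
  rw [EReal.coe_le_coe_iff, le_div_iff₀ hn'] at h2
  have hDπ : MF (D ∘ π) := fun a => H.cont.measurable (D1 a)
  have h3 : HH ν (D ∘ π) ≤ Real.log ((C1 * K) * Real.exp (n * h)) := by
    refine HH_le_log hDπ (by positivity) ?_
    rw [Fintype.card_coe, e3]
    refine (hsc n).trans ?_
    rw [mul_assoc]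
    gcongr
    exact (hg n).2
  rw [Real.log_mul (by positivity) (Real.exp_pos _).ne', Real.log_exp] at h3
  linarith

lemma Fac.map_eq (H : Fac f g π B p) (hα : IsExpansiveWith f α) (hM : GM f α h μ C c m)
    {ν : Measure X} [IsProbabilityMeasure ν]
    (hν : MeasurePreserving g ν ν) (he : mEntropy g ν = (h : EReal)) : ν.map π = μ := by
  have hα0 := hα.1
  have hπ := H.cont.measurable
  have : IsProbabilityMeasure (ν.map π) := Measure.isProbabilityMeasure_map hπ.aemeasurable
  refine hM.eq_of hα ⟨f.continuous.measurable, ?_⟩ ?_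
  · rw [Measure.map_map f.continuous.measurable hπ]
    have : f ∘ π = π ∘ g := by funext x; exact (H.comm x).symm
    rw [this, ← Measure.map_map hπ g.continuous.measurable, hν.map_eq]
  · intro n E D hn hD hDB
    have hn' : (0 : ℝ) < n := by exact_mod_cast hn
    have h1 := H.entropy_le hα hν hn hD (fun x y hxy => by
      have a1 := hDB x
      have a2 := hDB y
      rw [← hxy] at a2
      exact (BC.trans a1 (BC.symm a2)).mono (by linarith))
    rw [he, EReal.coe_le_coe_iff, le_div_iff₀ hn'] at h1
    have h2 : HH (ν.map π) D = HH ν (D ∘ π) := by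
      unfold HH
      refine Finset.sum_congr rfl fun a _ => ?_
      rw [measureReal_def, measureReal_def, Measure.map_apply hπ (hD a), preimage_comp]
    rw [h2]
    linarith

lemma HH_sub {ι : Type*} [Fintype ι] {ν : Measure X} [IsProbabilityMeasure ν]
    (hν : MeasurePreserving g ν ν) {cl : X → ι} (hcl : MF cl) (k n : ℕ) (hn : 0 < n) :
    HH ν (fun x (i : Fin (k * n)) => cl (g^[i] x)) ≤
      k * HH ν (fun x (i : Fin n) => cl (g^[i] x)) := by
  have hgm : ∀ j, Measurable g^[j] := fun j => (g.continuous.iterate j).measurable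
  have hX : MF (fun x (i : Fin n) => cl (g^[i] x)) :=
    MF.pi (X := fun (i : Fin n) x => cl (g^[i] x)) fun i => hcl.comp_meas (hgm i)
  set Y := fun x (i : Fin n) => cl (g^[i] x) with hY
  have hYm : ∀ j : Fin k, MF (Y ∘ g^[j.1 * n]) := fun j => hX.comp_meas (hgm _)
  have hYp : MF (fun x (j : Fin k) => (Y ∘ g^[j.1 * n]) x) := MF.pi hYm
  have e2 := HH_pi_le (ν := ν) k (fun j => Y ∘ g^[j.1 * n]) hYm
  have e2' : ∑ j : Fin k, HH ν (Y ∘ g^[j.1 * n]) = k * HH ν Y := by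
    rw [Finset.sum_congr rfl fun j _ => HH_comp_meas hX (hν.iterate _)]
    simp
  rw [e2'] at e2
  refine le_trans ?_ e2
  have hlt : ∀ i : Fin (k * n), i.1 / n < k := fun i =>
    Nat.div_lt_of_lt_mul ((i.2).trans_eq (mul_comm k n))
  have := HH_comp_le (ν := ν) hYp (fun (a : Fin k → Fin n → ι) (i : Fin (k * n)) =>
    a ⟨i.1 / n, hlt i⟩ ⟨i.1 % n, Nat.mod_lt _ hn⟩)
  refine le_trans (le_of_eq ?_) this
  congr 1
  funext x i
  simp only [Function.comp_apply, hY]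
  rw [← Function.iterate_add_apply, Nat.mod_add_div']

lemma Fac.le_entropy (H : Fac f g π B p) (hα : IsExpansiveWith f α) (hM : GM f α h μ C c m)
    {ν : Measure X} [IsProbabilityMeasure ν]
    (hν : MeasurePreserving g ν ν) (hmap : ν.map π = μ) : (h : EReal) ≤ mEntropy g ν := by
  classical
  have hα0 := hα.1
  have hπ := H.cont.measurable
  have hμ := hM.prob
  obtain ⟨E, hE⟩ := exists_cover f.continuous 1 (ε := α / 4) (by linarith)
  obtain ⟨D, D1, D2⟩ := exists_sel (ι := E) (fun e => Metric.ball (e : X) (α / 4))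
    (fun e => Metric.isOpen_ball.measurableSet) (fun x => by
      obtain ⟨e, he, hx⟩ := hE x
      exact ⟨⟨e, he⟩, hx 0 one_pos⟩)
  have hDπ : MF (D ∘ π) := fun a => hπ (D1 a)
  let P : Finset (Set X) := Finset.univ.image fun e : E => (D ∘ π) ⁻¹' {e}
  have hP : IsMPartition P := by
    refine ⟨?_, ?_, ?_⟩
    · intro A hA
      obtain ⟨e, -, rfl⟩ := Finset.mem_image.1 hA
      exact hDπ e
    · intro A hA A' hA' hne
      obtain ⟨e, -, rfl⟩ := Finset.mem_image.1 hA
      obtain ⟨e', -, rfl⟩ := Finset.mem_image.1 hA'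
      refine Set.disjoint_left.2 fun x hx hx' => hne ?_
      simp only [id, mem_preimage, mem_singleton_iff] at hx hx'
      rw [← hx, ← hx']
    · refine eq_univ_of_forall fun x => ?_
      exact ⟨_, Finset.mem_coe.2 (Finset.mem_image.2 ⟨(D ∘ π) x, Finset.mem_univ _, rfl⟩), rfl⟩
  obtain ⟨cl, hcl⟩ := exists_cl hP
  have hclm : MF cl := by
    intro A
    have : cl ⁻¹' {A} = (A : Set X) := by ext x; simp [hcl]
    rw [this]
    exact hP.1 _ A.2
  have hcd : ∀ x y, cl x = cl y → dist (π x) (π y) < α / 2 := by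
    intro x y hxy
    have h1 : x ∈ (cl x : Set X) := (hcl x _).1 rfl
    have h2 : y ∈ (cl x : Set X) := (hcl y _).1 hxy.symm
    obtain ⟨e, -, he⟩ := Finset.mem_image.1 (cl x).2
    rw [← he] at h1 h2
    have a1 := D2 (π x)
    have a2 := D2 (π y)
    have b1 : D (π x) = e := h1
    have b2 : D (π y) = e := h2
    rw [b1, Metric.mem_ball] at a1
    rw [b2, Metric.mem_ball] at a2
    have := dist_triangle_right (π x) (π y) e
    linarith
  have hlow : ∀ N : ℕ, N * h ≤ HH ν (fun x (i : Fin N) => cl (g^[i] x)) + Real.log C := by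
    intro N
    have hX : MF (fun x (i : Fin N) => cl (g^[i] x)) :=
      MF.pi (X := fun (i : Fin N) x => cl (g^[i] x)) fun i =>
        hclm.comp_meas (g.continuous.iterate i).measurable
    have hC := hM.hC
    have := le_HH (ν := ν) hX (t := C * Real.exp (-(N * h))) (by
      intro a
      rcases ((fun x (i : Fin N) => cl (g^[i] x)) ⁻¹' {a}).eq_empty_or_nonempty with h0 | ⟨x, hx⟩
      · rw [h0]; simp; positivity
      refine le_trans ?_ (hM.upper N (π x))
      rw [← hmap, measureReal_def, measureReal_def,
        Measure.map_apply hπ (isOpen_Bowen f.continuous _ _ _).measurableSet]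
      refine ENNReal.toReal_mono (measure_ne_top _ _) (measure_mono ?_)
      intro z hz j hj
      rw [← H.comm_iter, ← H.comm_iter]
      exact hcd _ _ ((congrFun hz ⟨j, hj⟩).trans (congrFun hx ⟨j, hj⟩).symm))
    rw [Real.log_mul hC.ne' (Real.exp_pos _).ne', Real.log_exp] at this
    linarith
  refine le_trans ?_ (le_iSup _ (⟨P, hP⟩ : {P : Finset (Set X) // IsMPartition P}))
  refine le_iInf fun n => ?_
  rw [EReal.coe_le_coe_iff, dynH_eq hcl, le_div_iff₀ (by positivity), mul_comm]
  refine le_of_lin (R := Real.log C) fun k hk => ?_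
  have h1 := hlow (k * (n + 1))
  have h2 := HH_sub hν hclm k (n + 1) (Nat.succ_pos n)
  push_cast at h1
  linarith

lemma Fac.unique (H : Fac f g π B p) (h0 : μ {p} = 0)
    {ν ν' : Measure X} (hm : ν.map π = μ) (hm' : ν'.map π = μ) : ν = ν' := by
  have hπ := H.cont.measurable
  have hBp : π ⁻¹' {p} = B := by ext x; simp [H.fib]
  have hBm : MeasurableSet B := hBp ▸ hπ (measurableSet_singleton p)
  have key : ∀ ν : Measure X, ν.map π = μ → ∀ S, MeasurableSet S → ν S = μ (π '' (S \ B)) := by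
    intro ν hm S hS
    have hB0 : ν B = 0 := by
      rw [← hBp, ← Measure.map_apply hπ (measurableSet_singleton p), hm, h0]
    have him : MeasurableSet (π '' (S \ B)) :=
      (hS.diff hBm).image_of_continuousOn_injOn H.cont.continuousOn
        (fun x hx y _ hxy => H.inj x y hx.2 hxy)
    rw [← hm, Measure.map_apply hπ him]
    have : π ⁻¹' (π '' (S \ B)) = S \ B := by
      refine Subset.antisymm ?_ (subset_preimage_image _ _)
      rintro y ⟨x, hx, hxy⟩
      rwa [← H.inj x y hx.2 hxy]
    rw [this, measure_sdiff_null hB0]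
  ext S hS
  rw [key ν hm S hS, key ν' hm' S hS]

lemma Fac.exists_lift (H : Fac f g π B p) : ∃ k : X → X, Measurable k ∧ ∀ y, π (k y) = y := by
  have hπ := H.cont.measurable
  have hBp : π ⁻¹' {p} = B := by ext x; simp [H.fib]
  have hBm : MeasurableSet B := hBp ▸ hπ (measurableSet_singleton p)
  refine ⟨Function.surjInv H.surj, fun S hS => ?_, Function.surjInv_eq H.surj⟩
  set k := Function.surjInv H.surj with hk
  have hk' : ∀ y, π (k y) = y := Function.surjInv_eq H.surj
  have him : MeasurableSet (π '' (S \ B)) :=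
    (hS.diff hBm).image_of_continuousOn_injOn H.cont.continuousOn
      (fun x hx y _ hxy => H.inj x y hx.2 hxy)
  have : k ⁻¹' S = π '' (S \ B) ∪ (k ⁻¹' S ∩ {p}) := by
    ext y
    constructor
    · intro hy
      by_cases hyp : y = p
      · exact Or.inr ⟨hy, hyp⟩
      · refine Or.inl ⟨k y, ⟨hy, fun hb => hyp ?_⟩, hk' y⟩
        rw [← hk' y]
        exact (H.fib _).2 hb
    · rintro (⟨x, hx, rfl⟩ | hy)
      · have := H.inj x (k (π x)) hx.2 (hk' _).symm
        rw [mem_preimage, ← this]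
        exact hx.1
      · exact hy.1
  rw [this]
  exact him.union (Set.Subsingleton.measurableSet
    (subsingleton_singleton.anti inter_subset_right))

lemma Fac.main (H : Fac f g π B p) (hα : IsExpansiveWith f α) (hs : HasSpecification f)
    (hp : f p = p) : ∃ ν : Measure X,
      (IsProbabilityMeasure ν ∧ Measure.map (⇑g) ν = ν ∧
        mEntropy (⇑g) ν = topEntropy (⇑g)) ∧
      ∀ ν' : Measure X, IsProbabilityMeasure ν' → Measure.map (⇑g) ν' = ν' →
        mEntropy (⇑g) ν' = topEntropy (⇑g) → ν' = ν := by
  have hne : Nonempty X := ⟨p⟩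
  have hπ := H.cont.measurable
  have hgm := g.continuous.measurable
  obtain ⟨h, K, hK, hg⟩ := growth hα hs
  obtain ⟨μ, C, c, m, b1, b2, b3, b4, b5, b6⟩ := bowen hα hs hK hg
  have hM : GM f α h μ C c m := ⟨b1, b2, b3, b4, b5, b6⟩
  rw [H.topEntropy_eq hα hK hg]
  have huniq : ∀ ν ν' : Measure X, IsProbabilityMeasure ν → IsProbabilityMeasure ν' →
      ν.map π = μ → ν'.map π = μ → ν = ν' := by
    intro ν ν' _ _ h1 h2
    by_cases h0 : μ {p} = 0
    · exact H.unique h0 h1 h2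
    · have hx := hM.sing hα hp h0
      have hsub : Subsingleton X := ⟨fun x y => (hx x).trans (hx y).symm⟩
      ext S _
      rcases S.eq_empty_or_nonempty with rfl | hS
      · simp
      · rw [hS.eq_univ]
        simp
  obtain ⟨k, k1, k2⟩ := H.exists_lift
  have hpν : IsProbabilityMeasure (μ.map k) := Measure.isProbabilityMeasure_map k1.aemeasurable
  have hmap : (μ.map k).map π = μ := by
    rw [Measure.map_map hπ k1]
    have : π ∘ k = id := by funext y; exact k2 y
    rw [this, Measure.map_id]
  have hinv : (μ.map k).map g = μ.map k := by
    refine huniq _ _ (Measure.isProbabilityMeasure_map hgm.aemeasurable) hpν ?_ hmap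
    rw [Measure.map_map hπ hgm]
    have : π ∘ g = f ∘ π := by funext x; exact H.comm x
    rw [this, ← Measure.map_map f.continuous.measurable hπ, hmap, b2.map_eq]
  refine ⟨μ.map k, ⟨hpν, hinv, ?_⟩, ?_⟩
  · exact le_antisymm (H.entropy_le_h hα hK hg ⟨hgm, hinv⟩) (H.le_entropy hα hM ⟨hgm, hinv⟩ hmap)
  · intro ν' hp' hi' he'
    exact huniq _ _ hp' hpν (H.map_eq hα hM ⟨hgm, hi'⟩ he') hmap

end G

end Blow

/-- Blowing up a fixed point of an expansive homeomorphism with specification yields a map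
with a unique measure of maximal entropy. -/
theorem blowup_unique_mme
    {M : Type*} [MetricSpace M] [CompactSpace M] [MeasurableSpace M] [BorelSpace M]
    (f : M ≃ₜ M) (hexp : IsExpansive f) (hspec : HasSpecification f)
    (p : M) (hp : f p = p) (R : ℝ) (hR : 0 < R)
    (h : M → M) (hcont : Continuous h)
    (hB : h '' Metric.closedBall p R = {p})
    (hbij : Set.BijOn h (Metric.closedBall p R)ᶜ ({p}ᶜ))
    (g : M ≃ₜ M)
    (hgB : (⇑g) '' Metric.closedBall p R = Metric.closedBall p R)
    (hent : relEntropy (⇑g) (Metric.closedBall p R) = 0)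
    (hout : ∀ x ∉ Metric.closedBall p R,
      g x ∉ Metric.closedBall p R ∧ h (g x) = f (h x)) :
    ∃ ν : Measure M,
      (IsProbabilityMeasure ν ∧ Measure.map (⇑g) ν = ν ∧
        mEntropy (⇑g) ν = topEntropy (⇑g)) ∧
      ∀ ν' : Measure M, IsProbabilityMeasure ν' → Measure.map (⇑g) ν' = ν' →
        mEntropy (⇑g) ν' = topEntropy (⇑g) → ν' = ν := by
  obtain ⟨α, hα⟩ := hexp
  have hin : ∀ x ∈ Metric.closedBall p R, h x = p := fun x hx => by
    have : h x ∈ h '' Metric.closedBall p R := mem_image_of_mem h hx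
    rw [hB] at this
    exact this
  have hnot : ∀ x, x ∉ Metric.closedBall p R → h x ≠ p := fun x hx => hbij.mapsTo hx
  have hfib : ∀ x, h x = p ↔ x ∈ Metric.closedBall p R := fun x =>
    ⟨fun hx => by_contra fun hn => hnot x hn hx, hin x⟩
  have H : Blow.Fac f g h (Metric.closedBall p R) p :=
    { cont := hcont
      comm := by
        intro x
        by_cases hx : x ∈ Metric.closedBall p R
        · have hgx : g x ∈ Metric.closedBall p R := by
            have : g x ∈ (⇑g) '' Metric.closedBall p R := mem_image_of_mem g hx
            rwa [hgB] at this
          rw [hin _ hgx, hin _ hx, hp]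
        · exact (hout x hx).2
      fib := hfib
      inj := by
        intro x y hx hxy
        refine hbij.injOn hx (fun hy => hnot x hx ?_) hxy
        rw [hxy]
        exact hin y hy
      surj := by
        intro y
        by_cases hy : y = p
        · exact ⟨p, by rw [hy]; exact hin p (Metric.mem_closedBall_self hR.le)⟩
        · obtain ⟨x, -, hx⟩ := hbij.surjOn hy
          exact ⟨x, hx⟩
      ent := hent }
  exact H.main hα hspec hp
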